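/- arXiv:2210.07974 — 8 statements merged into one kernel-verified Lean document; each statement's English description precedes it below -/
import Mathlib

section
/- Geometric invariance of one step of PN subdivision: let R be a d×d orthogonal matrix (RᵀR = I), t ∈ ℝ^d a translation vector and s > 0 a scale factor. If one PN subdivision step applied to data (p_j, n_j)_{j∈ℤ} is well defined and produces new normals n'_i and new points p'_i, then one PN subdivision step applied to the transformed data (s·R p_j + t, R n_j)_{j∈ℤ} is well defined and produces new normals R n'_i and new points s·R p'_i + t, for every i ∈ ℤ. -/
open scoped RealInnerProductSpace BigOperators Matrix

noncomputable section

variable {d : ℕ}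

/-- The linearly subdivided point `q_i = Σ_j a_{i-2j} p_j` (also used for the
unnormalized subdivided normal `ν_i = Σ_j a_{i-2j} n_j`). -/
def pnQ (a : ℤ → ℝ) (p : ℤ → EuclideanSpace ℝ (Fin d)) (i : ℤ) :
    EuclideanSpace ℝ (Fin d) :=
  ∑ᶠ j : ℤ, a (i - 2 * j) • p j

/-- The new normal `n'_i = ν_i / ‖ν_i‖`. -/
def pnN (a : ℤ → ℝ) (n : ℤ → EuclideanSpace ℝ (Fin d)) (i : ℤ) :
    EuclideanSpace ℝ (Fin d) :=
  ‖pnQ a n i‖⁻¹ • pnQ a n i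

/-- The height `h_{ij} = ⟨n_j + n'_i, p_j − q_i⟩ / ⟨n_j + n'_i, n'_i⟩`. -/
def pnH (a : ℤ → ℝ) (p n : ℤ → EuclideanSpace ℝ (Fin d)) (i j : ℤ) : ℝ :=
  ⟪n j + pnN a n i, p j - pnQ a p i⟫ / ⟪n j + pnN a n i, pnN a n i⟫

/-- The new point `p'_i = q_i + (Σ_j a_{i-2j} h_{ij}) n'_i`. -/
def pnP (a : ℤ → ℝ) (p n : ℤ → EuclideanSpace ℝ (Fin d)) (i : ℤ) :
    EuclideanSpace ℝ (Fin d) :=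
  pnQ a p i + (∑ᶠ j : ℤ, a (i - 2 * j) * pnH a p n i j) • pnN a n i

/-- One PN subdivision step is well defined: all `ν_i ≠ 0`, and
`⟨n_j + n'_i, n'_i⟩ ≠ 0` whenever `a_{i-2j} ≠ 0`. -/
def pnWellDefined (a : ℤ → ℝ) (p n : ℤ → EuclideanSpace ℝ (Fin d)) : Prop :=
  (∀ i : ℤ, pnQ a n i ≠ 0) ∧
    ∀ i j : ℤ, a (i - 2 * j) ≠ 0 → ⟪n j + pnN a n i, pnN a n i⟫ ≠ 0

theorem finite_support_comp_sub_two_mul {a : ℤ → ℝ} (ha : (Function.support a).Finite) (i : ℤ) :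
    (Function.support fun j : ℤ => a (i - 2 * j)).Finite :=
  ha.preimage (f := fun j : ℤ => i - 2 * j) fun x _ y _ h => by
    simp only at h
    omega

theorem finite_support_mask_smul {a : ℤ → ℝ} (ha : (Function.support a).Finite)
    (v : ℤ → EuclideanSpace ℝ (Fin d)) (i : ℤ) :
    (Function.support fun j : ℤ => a (i - 2 * j) • v j).Finite :=
  (finite_support_comp_sub_two_mul ha i).subset fun j hj h => hj (by simp [h])

theorem Matrix.inner_toEuclideanLin_of_transpose_mul_self {R : Matrix (Fin d) (Fin d) ℝ}
    (hR : Rᵀ * R = 1) (x y : EuclideanSpace ℝ (Fin d)) :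
    ⟪Matrix.toEuclideanLin R x, Matrix.toEuclideanLin R y⟫ = ⟪x, y⟫ := by
  rw [← LinearMap.adjoint_inner_left, ← Matrix.toEuclideanLin_conjTranspose_eq_adjoint,
    Matrix.conjTranspose_eq_transpose_of_trivial]
  simp [Matrix.toLpLin_apply, Matrix.mulVec_mulVec, hR]

/-- The linear isometry given by a matrix with `Rᵀ * R = 1`. -/
def Matrix.orthogonalIsometry (R : Matrix (Fin d) (Fin d) ℝ) (hR : Rᵀ * R = 1) :
    EuclideanSpace ℝ (Fin d) →ₗᵢ[ℝ] EuclideanSpace ℝ (Fin d) :=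
  (Matrix.toEuclideanLin R).isometryOfInner
    (Matrix.inner_toEuclideanLin_of_transpose_mul_self hR)

section Invariance

variable {a : ℤ → ℝ} (L : EuclideanSpace ℝ (Fin d) →ₗᵢ[ℝ] EuclideanSpace ℝ (Fin d))

theorem pnQ_map (ha : (Function.support a).Finite)
    (n : ℤ → EuclideanSpace ℝ (Fin d)) (i : ℤ) :
    pnQ a (fun j => L (n j)) i = L (pnQ a n i) := by
  simpa [pnQ] using
    (L.toLinearMap.toAddMonoidHom.map_finsum (finite_support_mask_smul ha n i)).symm

theorem pnQ_similarity (ha : (Function.support a).Finite)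
    (haff : ∀ i : ℤ, ∑ᶠ j : ℤ, a (i - 2 * j) = 1)
    (p : ℤ → EuclideanSpace ℝ (Fin d)) (t : EuclideanSpace ℝ (Fin d)) (s : ℝ) (i : ℤ) :
    pnQ a (fun j => s • L (p j) + t) i = s • L (pnQ a p i) + t := by
  rw [← pnQ_map L ha]
  simp only [pnQ, smul_add]
  rw [finsum_add_distrib (finite_support_mask_smul ha (fun j => s • L (p j)) i)
      (finite_support_mask_smul ha (fun _ => t) i),
    ← finsum_smul, haff, one_smul, smul_finsum]
  simp only [smul_comm s]

theorem pnN_map (ha : (Function.support a).Finite)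
    (n : ℤ → EuclideanSpace ℝ (Fin d)) (i : ℤ) :
    pnN a (fun j => L (n j)) i = L (pnN a n i) := by
  simp [pnN, pnQ_map L ha]

theorem pnH_similarity (ha : (Function.support a).Finite)
    (haff : ∀ i : ℤ, ∑ᶠ j : ℤ, a (i - 2 * j) = 1)
    (p n : ℤ → EuclideanSpace ℝ (Fin d)) (t : EuclideanSpace ℝ (Fin d)) (s : ℝ) (i j : ℤ) :
    pnH a (fun j => s • L (p j) + t) (fun j => L (n j)) i j = s * pnH a p n i j := by
  simp only [pnH, pnN_map L ha, pnQ_similarity L ha haff, add_sub_add_right_eq_sub, ← smul_sub,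
    ← map_sub, ← map_add, inner_smul_right, L.inner_map_map, mul_div_assoc]

theorem pnP_similarity (ha : (Function.support a).Finite)
    (haff : ∀ i : ℤ, ∑ᶠ j : ℤ, a (i - 2 * j) = 1)
    (p n : ℤ → EuclideanSpace ℝ (Fin d)) (t : EuclideanSpace ℝ (Fin d)) (s : ℝ) (i : ℤ) :
    pnP a (fun j => s • L (p j) + t) (fun j => L (n j)) i = s • L (pnP a p n i) + t := by
  have hsum : ∑ᶠ j : ℤ, a (i - 2 * j) * (s * pnH a p n i j)
      = s * ∑ᶠ j : ℤ, a (i - 2 * j) * pnH a p n i j := by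
    simp only [mul_left_comm _ s]
    exact (smul_finsum s _).symm
  simp only [pnP, pnQ_similarity L ha haff, pnH_similarity L ha haff, pnN_map L ha, hsum,
    map_add, map_smul, smul_add, mul_smul]
  abel

theorem pnWellDefined.map (ha : (Function.support a).Finite)
    {p n : ℤ → EuclideanSpace ℝ (Fin d)} (hwd : pnWellDefined a p n)
    (p' : ℤ → EuclideanSpace ℝ (Fin d)) :
    pnWellDefined a p' (fun j => L (n j)) := by
  refine ⟨fun i => ?_, fun i j hij => ?_⟩
  · rw [pnQ_map L ha]
    exact (map_ne_zero_iff L L.injective).2 (hwd.1 i)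
  · rw [pnN_map L ha, ← map_add, L.inner_map_map]
    exact hwd.2 i j hij

end Invariance

/-- Geometric invariance of one step of PN subdivision.  If `R` is an
orthogonal `d×d` matrix, `t` a translation and `s > 0` a scale factor, and one PN
subdivision step applied to `(p_j, n_j)` is well defined, producing normals `n'_i` and
points `p'_i`, then the PN step applied to `(s·R p_j + t, R n_j)` is well defined and
produces normals `R n'_i` and points `s·R p'_i + t`. -/
theorem pn_step_geometric_invariance
    (a : ℤ → ℝ) (ha : (Function.support a).Finite)
    (haff : ∀ i : ℤ, ∑ᶠ j : ℤ, a (i - 2 * j) = 1)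
    (p n : ℤ → EuclideanSpace ℝ (Fin d))
    (hunit : ∀ j : ℤ, ‖n j‖ = 1)
    (R : Matrix (Fin d) (Fin d) ℝ) (hR : Rᵀ * R = 1)
    (t : EuclideanSpace ℝ (Fin d)) (s : ℝ) (hs : 0 < s)
    (hwd : pnWellDefined a p n) :
    pnWellDefined a (fun j => s • Matrix.toEuclideanLin R (p j) + t)
        (fun j => Matrix.toEuclideanLin R (n j)) ∧
      (∀ i : ℤ, pnN a (fun j => Matrix.toEuclideanLin R (n j)) i
          = Matrix.toEuclideanLin R (pnN a n i)) ∧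
      (∀ i : ℤ, pnP a (fun j => s • Matrix.toEuclideanLin R (p j) + t)
            (fun j => Matrix.toEuclideanLin R (n j)) i
          = s • Matrix.toEuclideanLin R (pnP a p n i) + t) := by
  let L := R.orthogonalIsometry hR
  exact ⟨hwd.map L ha _, pnN_map L ha n, pnP_similarity L ha haff p n t s⟩
end
end

section
/- Circle preservation of PN subdivision: let d = 2 and suppose the initial data lie on the unit circle with coinciding points and normals, i.e. p_j = n_j and ‖n_j‖ = 1 for all j ∈ ℤ. Assume ν_i = Σ_j a_{i−2j} n_j ≠ 0 and ⟨n_j + n'_i, n'_i⟩ ≠ 0 whenever a_{i−2j} ≠ 0. Then for every i ∈ ℤ the newly subdivided point equals the newly subdivided normal, p'_i = n'_i; in particular ‖p'_i‖ = 1, so all points produced by one PN subdivision step lie on the same unit circle. -/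
open scoped RealInnerProductSpace BigOperators Matrix

noncomputable section

variable {d : ℕ}

/-- On the unit sphere, with coinciding points and normals, every height equals `1 - ‖ν_i‖`. -/
theorem pnH_self_of_norm_eq_one (a : ℤ → ℝ) (n : ℤ → EuclideanSpace ℝ (Fin d)) (i j : ℤ)
    (hj : ‖n j‖ = 1) (hν : pnQ a n i ≠ 0)
    (hden : ⟪n j + pnN a n i, pnN a n i⟫ ≠ 0) :
    pnH a n n i j = 1 - ‖pnQ a n i‖ := by
  have hm : ‖pnN a n i‖ = 1 := norm_smul_inv_norm (𝕜 := ℝ) hν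
  have hq : ∀ x, ⟪x, pnQ a n i⟫ = ‖pnQ a n i‖ * ⟪x, pnN a n i⟫ := fun x => by
    rw [← real_inner_smul_right, pnN, smul_inv_smul₀ (norm_ne_zero_iff.mpr hν)]
  have hnn : ⟪n j, n j⟫ = (1 : ℝ) := by simp [hj]
  have hmm : ⟪pnN a n i, pnN a n i⟫ = (1 : ℝ) := by simp [hm]
  have hsymm : ⟪pnN a n i, n j⟫ = ⟪n j, pnN a n i⟫ := real_inner_comm _ _
  rw [pnH, div_eq_iff hden]
  simp only [inner_add_left, inner_sub_right, hq, hnn, hmm, hsymm]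
  ring

/-- Circle preservation of PN subdivision.  In `ℝ²`, if the initial data
lie on the unit circle with coinciding points and normals (`p_j = n_j`, `‖n_j‖ = 1`),
and the step is well defined, then the new point coincides with the new normal,
`p'_i = n'_i`, and in particular `‖p'_i‖ = 1`. -/
theorem pn_step_circle_preserving
    (a : ℤ → ℝ) (ha : (Function.support a).Finite)
    (haff : ∀ i : ℤ, ∑ᶠ j : ℤ, a (i - 2 * j) = 1)
    (p n : ℤ → EuclideanSpace ℝ (Fin 2))
    (hpn : ∀ j : ℤ, p j = n j)
    (hunit : ∀ j : ℤ, ‖n j‖ = 1)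
    (hν : ∀ i : ℤ, pnQ a n i ≠ 0)
    (hden : ∀ i j : ℤ, a (i - 2 * j) ≠ 0 → ⟪n j + pnN a n i, pnN a n i⟫ ≠ 0) :
    ∀ i : ℤ, pnP a p n i = pnN a n i ∧ ‖pnP a p n i‖ = 1 := by
  obtain rfl : p = n := funext hpn
  intro i
  have hm : ‖pnN a p i‖ = 1 := norm_smul_inv_norm (𝕜 := ℝ) (hν i)
  have hq : ‖pnQ a p i‖ • pnN a p i = pnQ a p i :=
    smul_inv_smul₀ (norm_ne_zero_iff.mpr (hν i)) _
  have hterm : ∀ j : ℤ, a (i - 2 * j) * pnH a p p i j = a (i - 2 * j) * (1 - ‖pnQ a p i‖) := by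
    intro j
    by_cases hj : a (i - 2 * j) = 0
    · simp [hj]
    · rw [pnH_self_of_norm_eq_one a p i j (hunit j) (hν i) (hden i j hj)]
  have hfin : (Function.support fun j : ℤ => a (i - 2 * j)).Finite :=
    ha.preimage fun x _ y _ (hxy : i - 2 * x = i - 2 * y) => by lia
  have hP : pnP a p p i = pnN a p i := by
    rw [pnP, finsum_congr hterm, ← finsum_mul' _ _ hfin, haff, one_mul]
    nth_rewrite 1 [← hq]
    rw [← add_smul, add_sub_cancel, one_smul]
  exact ⟨hP, hP ▸ hm⟩
end
end

section
/- Sphere preservation of PN subdivision: let d = 3 and suppose the initial data lie on the unit sphere with coinciding points and normals, i.e. p_j = n_j and ‖n_j‖ = 1 for all j ∈ ℤ. Assume ν_i = Σ_j a_{i−2j} n_j ≠ 0 and ⟨n_j + n'_i, n'_i⟩ ≠ 0 whenever a_{i−2j} ≠ 0. Then for every i ∈ ℤ the newly subdivided point equals the newly subdivided normal, p'_i = n'_i; in particular ‖p'_i‖ = 1, so all points produced by one PN subdivision step lie on the same unit sphere. -/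
open scoped RealInnerProductSpace BigOperators Matrix

noncomputable section

variable {d : ℕ}

theorem norm_pnN {a : ℤ → ℝ} {n : ℤ → EuclideanSpace ℝ (Fin d)} {i : ℤ}
    (hν : pnQ a n i ≠ 0) : ‖pnN a n i‖ = 1 :=
  norm_smul_inv_norm (𝕜 := ℝ) hν

theorem norm_smul_pnN {a : ℤ → ℝ} {n : ℤ → EuclideanSpace ℝ (Fin d)} {i : ℤ}
    (hν : pnQ a n i ≠ 0) : ‖pnQ a n i‖ • pnN a n i = pnQ a n i :=
  smul_inv_smul₀ (norm_ne_zero_iff.mpr hν) _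

/-- For data on the unit sphere, all heights at `i` are equal to `1 - ‖ν_i‖`. -/
theorem pnH_self_eq {a : ℤ → ℝ} {n : ℤ → EuclideanSpace ℝ (Fin d)} {i j : ℤ}
    (hunit : ‖n j‖ = 1) (hν : pnQ a n i ≠ 0)
    (hden : ⟪n j + pnN a n i, pnN a n i⟫ ≠ 0) :
    pnH a n n i j = 1 - ‖pnQ a n i‖ := by
  have hsplit : n j - pnQ a n i =
      (n j - pnN a n i) + (1 - ‖pnQ a n i‖) • pnN a n i := by
    rw [sub_smul, one_smul, norm_smul_pnN hν]
    abel
  have horth : ⟪n j + pnN a n i, n j - pnN a n i⟫ = 0 :=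
    (real_inner_add_sub_eq_zero_iff _ _).mpr (hunit.trans (norm_pnN hν).symm)
  rw [pnH, div_eq_iff hden, hsplit, inner_add_right, horth, inner_smul_right, zero_add]

/-- For data on the unit sphere, the new point is the new normal (in any dimension). -/
theorem pnP_self_eq_pnN {a : ℤ → ℝ} {n : ℤ → EuclideanSpace ℝ (Fin d)} {i : ℤ}
    (haff : ∑ᶠ j : ℤ, a (i - 2 * j) = 1) (hunit : ∀ j : ℤ, ‖n j‖ = 1)
    (hν : pnQ a n i ≠ 0)
    (hden : ∀ j : ℤ, a (i - 2 * j) ≠ 0 → ⟪n j + pnN a n i, pnN a n i⟫ ≠ 0) :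
    pnP a n n i = pnN a n i := by
  have hterm : ∀ j : ℤ,
      a (i - 2 * j) * pnH a n n i j = a (i - 2 * j) * (1 - ‖pnQ a n i‖) := by
    intro j
    by_cases hj : a (i - 2 * j) = 0
    · simp [hj]
    · rw [pnH_self_eq (hunit j) hν (hden j hj)]
  have hsum : ∑ᶠ j : ℤ, a (i - 2 * j) * pnH a n n i j = 1 - ‖pnQ a n i‖ := by
    rw [finsum_congr hterm, ← finsum_mul, haff, one_mul]
  rw [pnP, hsum, sub_smul, one_smul, norm_smul_pnN hν, add_sub_cancel]

/-- Sphere preservation of PN subdivision.  In `ℝ³`, if the initial data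
lie on the unit sphere with coinciding points and normals (`p_j = n_j`, `‖n_j‖ = 1`),
and the step is well defined, then the new point coincides with the new normal,
`p'_i = n'_i`, and in particular `‖p'_i‖ = 1`. -/
theorem pn_step_sphere_preserving
    (a : ℤ → ℝ) (ha : (Function.support a).Finite)
    (haff : ∀ i : ℤ, ∑ᶠ j : ℤ, a (i - 2 * j) = 1)
    (p n : ℤ → EuclideanSpace ℝ (Fin 3))
    (hpn : ∀ j : ℤ, p j = n j)
    (hunit : ∀ j : ℤ, ‖n j‖ = 1)
    (hν : ∀ i : ℤ, pnQ a n i ≠ 0)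
    (hden : ∀ i j : ℤ, a (i - 2 * j) ≠ 0 → ⟪n j + pnN a n i, pnN a n i⟫ ≠ 0) :
    ∀ i : ℤ, pnP a p n i = pnN a n i ∧ ‖pnP a p n i‖ = 1 := by
  intro i
  obtain rfl : p = n := funext hpn
  have h := pnP_self_eq_pnN (haff i) hunit (hν i) (hden i)
  exact ⟨h, h ▸ norm_pnN (hν i)⟩
end
end

section
/- Decay of the nonlinear perturbation matrices near an extraordinary vertex (Lemma 2): let S = (s_{ij})_{0≤i,j≤L} be a real (L+1)×(L+1) matrix and let n_j^k ∈ ℝ³ (0 ≤ j ≤ L, k ∈ ℕ) be unit vectors satisfying (i) ‖n_j^k − n_l^k‖ ≤ c₂ γ^k for all j, l ∈ {0,…,L} and all k ∈ ℕ, where c₂ > 0 and 0 < γ < 1 are constants (as holds when the normals are refined from a standard subdivision matrix by linear averaging followed by normalization onto the unit sphere), and (ii) ⟨n_i^{k+1}, n_j^k⟩ ≥ 0 for all i, j, k. Define A_{ij}^k = A(n_i^{k+1}, n_j^k) and M̃_{ij}^k = I + Σ_{l=0}^{L} s_{il}(A_{ij}^k − A_{il}^k). Then there exists a constant K_M > 0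 such that ‖M̃_{ij}^k − I‖ ≤ K_M γ^k for all i, j ∈ {0,…,L} and all k ∈ ℕ. -/
open scoped RealInnerProductSpace BigOperators

noncomputable section

/-- The projection map `A(X₁, X₂) : v ↦ (⟨X₁ + X₂, v⟩ / ⟨X₁ + X₂, X₁⟩) · X₁`,
i.e. `A(X₁,X₂) = X₁(X₁+X₂)ᵀ / ((X₁+X₂)ᵀX₁)` in matrix form. -/
def Amap {d : ℕ} (X₁ X₂ : EuclideanSpace ℝ (Fin d)) :
    EuclideanSpace ℝ (Fin d) →L[ℝ] EuclideanSpace ℝ (Fin d) :=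
  (⟪X₁ + X₂, X₁⟫)⁻¹ • (innerSL ℝ (X₁ + X₂)).smulRight X₁

lemma norm_inv_smul_sub_inv_smul_le {E : Type*} [NormedAddCommGroup E] [NormedSpace ℝ E]
    {u w : E} {a b : ℝ} (ha : 1 ≤ a) (hb : 1 ≤ b) :
    ‖a⁻¹ • u - b⁻¹ • w‖ ≤ ‖u - w‖ + |a - b| * ‖w‖ := by
  have ha₀ : a ≠ 0 := by positivity
  have hb₀ : b ≠ 0 := by positivity
  have hsplit : a⁻¹ • u - b⁻¹ • w = a⁻¹ • (u - w) + (a⁻¹ * b⁻¹ * (b - a)) • w := by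
    have : a⁻¹ * b⁻¹ * (b - a) = a⁻¹ - b⁻¹ := by field_simp
    rw [this]
    module
  have ha₁ : a⁻¹ ≤ 1 := inv_le_one_of_one_le₀ ha
  have hb₁ : b⁻¹ ≤ 1 := inv_le_one_of_one_le₀ hb
  have hab : a⁻¹ * b⁻¹ ≤ 1 := mul_le_one₀ ha₁ (by positivity) hb₁
  rw [hsplit]
  refine (norm_add_le _ _).trans (add_le_add ?_ ?_)
  · rw [norm_smul, Real.norm_of_nonneg (by positivity)]
    exact mul_le_of_le_one_left (norm_nonneg _) ha₁
  · rw [norm_smul, Real.norm_eq_abs, abs_mul, abs_sub_comm b a,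
      abs_of_nonneg (show 0 ≤ a⁻¹ * b⁻¹ by positivity)]
    gcongr
    exact mul_le_of_le_one_left (abs_nonneg _) hab

lemma Amap_eq_smulRight {d : ℕ} (X Y : EuclideanSpace ℝ (Fin d)) :
    Amap X Y = (innerSL ℝ (⟪X + Y, X⟫⁻¹ • (X + Y))).smulRight X := by
  ext1 v
  simp only [Amap, smul_apply, ContinuousLinearMap.smulRight_apply,
    innerSL_apply_apply, real_inner_smul_left, smul_smul]

/-- On the unit sphere, `A(X, ·)` is Lipschitz with constant `3` on the hemisphere around `X`. -/
lemma norm_Amap_sub_Amap_le {d : ℕ} {X Y Z : EuclideanSpace ℝ (Fin d)}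
    (hX : ‖X‖ = 1) (hZ : ‖Z‖ = 1) (hXY : 0 ≤ ⟪X, Y⟫) (hXZ : 0 ≤ ⟪X, Z⟫) :
    ‖Amap X Y - Amap X Z‖ ≤ 3 * ‖Y - Z‖ := by
  have hinner (W : EuclideanSpace ℝ (Fin d)) : ⟪X + W, X⟫ = 1 + ⟪X, W⟫ := by
    rw [inner_add_left, real_inner_self_eq_norm_sq, hX, real_inner_comm]
    norm_num
  have hsub : Amap X Y - Amap X Z =
      (innerSL ℝ (⟪X + Y, X⟫⁻¹ • (X + Y) - ⟪X + Z, X⟫⁻¹ • (X + Z))).smulRight X := by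
    rw [Amap_eq_smulRight, Amap_eq_smulRight]
    ext1 v
    simp only [sub_apply, ContinuousLinearMap.smulRight_apply,
      innerSL_apply_apply, inner_sub_left, sub_smul]
  have hdiff : |⟪X + Y, X⟫ - ⟪X + Z, X⟫| ≤ ‖Y - Z‖ := by
    rw [hinner, hinner, add_sub_add_left_eq_sub, ← inner_sub_right]
    simpa [hX] using abs_real_inner_le_norm X (Y - Z)
  have hsum : ‖X + Z‖ ≤ 2 := (norm_add_le _ _).trans (by rw [hX, hZ]; norm_num)
  rw [hsub, ContinuousLinearMap.norm_smulRight_apply, innerSL_apply_norm, hX, mul_one]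
  calc _ ≤ ‖(X + Y) - (X + Z)‖ + |⟪X + Y, X⟫ - ⟪X + Z, X⟫| * ‖X + Z‖ :=
        norm_inv_smul_sub_inv_smul_le (by rw [hinner]; linarith) (by rw [hinner]; linarith)
    _ ≤ ‖Y - Z‖ + ‖Y - Z‖ * 2 := by
        rw [add_sub_add_left_eq_sub]
        gcongr
    _ = 3 * ‖Y - Z‖ := by ring

/-- Decay of the nonlinear perturbation matrices near an extraordinary
vertex (Lemma 2).  Given a real `(L+1)×(L+1)` matrix `S` and unit vectors
`n_j^k ∈ ℝ³` with `‖n_j^k − n_l^k‖ ≤ c₂ γ^k` and `⟨n_i^{k+1}, n_j^k⟩ ≥ 0`, the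
matrices `M̃_{ij}^k = I + Σ_l s_{il}(A_{ij}^k − A_{il}^k)` with
`A_{ij}^k = A(n_i^{k+1}, n_j^k)` satisfy `‖M̃_{ij}^k − I‖ ≤ K_M γ^k`. -/
theorem pn_Mtilde_decay (L : ℕ) (S : Matrix (Fin (L + 1)) (Fin (L + 1)) ℝ)
    (n : ℕ → Fin (L + 1) → EuclideanSpace ℝ (Fin 3))
    (hunit : ∀ (k : ℕ) (j : Fin (L + 1)), ‖n k j‖ = 1)
    (c₂ γ : ℝ) (hc₂ : 0 < c₂) (hγ₀ : 0 < γ) (hγ₁ : γ < 1)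
    (hclose : ∀ (k : ℕ) (j l : Fin (L + 1)), ‖n k j - n k l‖ ≤ c₂ * γ ^ k)
    (hinner : ∀ (k : ℕ) (i j : Fin (L + 1)), 0 ≤ ⟪n (k + 1) i, n k j⟫) :
    ∃ K_M > (0 : ℝ), ∀ (k : ℕ) (i j : Fin (L + 1)),
      ‖(1 + ∑ l : Fin (L + 1),
            S i l • (Amap (n (k + 1) i) (n k j) - Amap (n (k + 1) i) (n k l)))
          - (1 : EuclideanSpace ℝ (Fin 3) →L[ℝ] EuclideanSpace ℝ (Fin 3))‖
        ≤ K_M * γ ^ k := by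
  refine ⟨(1 + ∑ i, ∑ l, |S i l|) * (3 * c₂), by positivity, fun k i j => ?_⟩
  have hrow : ∑ l, |S i l| ≤ 1 + ∑ i, ∑ l, |S i l| := by
    have := Finset.single_le_sum (f := fun i => ∑ l, |S i l|)
      (fun i _ => Finset.sum_nonneg fun l _ => abs_nonneg (S i l)) (Finset.mem_univ i)
    linarith
  rw [add_sub_cancel_left]
  calc _ ≤ ∑ l, |S i l| * (3 * (c₂ * γ ^ k)) := by
        refine norm_sum_le_of_le _ fun l _ => ?_
        rw [norm_smul, Real.norm_eq_abs]
        gcongr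
        exact (norm_Amap_sub_Amap_le (hunit _ _) (hunit _ _) (hinner k i j) (hinner k i l)).trans
          (mul_le_mul_of_nonneg_left (hclose k j l) (by norm_num))
    _ = (∑ l, |S i l|) * (3 * (c₂ * γ ^ k)) := by rw [Finset.sum_mul]
    _ ≤ (1 + ∑ i, ∑ l, |S i l|) * (3 * (c₂ * γ ^ k)) := by gcongr
    _ = _ := by ring
end
end

section
/- Stability of the perturbed subdivision process (stability part of Theorem 3): let S and S_k (k ∈ ℕ) be real n×n matrices such that the powers of S are uniformly bounded, i.e. there is C₀ > 0 with ‖S^m‖ ≤ C₀ for all m ∈ ℕ, and such that Σ_{k∈ℕ} ‖S_k − S‖ < +∞ (in particular this holds when ‖S_k − S‖ ≤ c γ^k for constants c > 0 and 0 < γ < 1). Then the products of the perturbed matrices are uniformly bounded: there exists a constant K > 0 such that ‖S_{k+m} ⋯ S_{k+1} S_k‖ ≤ K for all k, m ∈ ℕ. -/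
open scoped BigOperators

/- Matrices are equipped with the `L∞` operator norm
`‖M‖ = max_i Σ_j |M i j|`, a submultiplicative operator norm. -/
attribute [local instance] Matrix.linftyOpNormedRing Matrix.linftyOpNormedAddCommGroup

noncomputable section

/-- The product `S_{k+m} ⋯ S_{k+1} S_k` of the perturbed subdivision matrices. -/
def prodFrom {n : ℕ} (T : ℕ → Matrix (Fin n) (Fin n) ℝ) (k : ℕ) :
    ℕ → Matrix (Fin n) (Fin n) ℝ
  | 0 => T k
  | m + 1 => T (k + (m + 1)) * prodFrom T k m

/-- If the powers of `S` are bounded by `C`, then left multiplication by `T` increases a common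
bound of all `‖S ^ j * P‖` at most by the factor
`exp (C * ‖T - S‖)`. -/
theorem norm_pow_mul_mul_le_mul_exp {R : Type*} [SeminormedRing R] {S T P : R} {C B : ℝ}
    (hpow : ∀ m : ℕ, ‖S ^ m‖ ≤ C) (hP : ∀ j : ℕ, ‖S ^ j * P‖ ≤ B) (j : ℕ) :
    ‖S ^ j * (T * P)‖ ≤ B * Real.exp (C * ‖T - S‖) := by
  have hB : 0 ≤ B := (norm_nonneg _).trans (hP 0)
  have hC : 0 ≤ C := (norm_nonneg _).trans (hpow 0)
  have hP' : ‖P‖ ≤ B := by simpa using hP 0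
  have hsplit : S ^ j * (T * P) = S ^ (j + 1) * P + S ^ j * (T - S) * P := by
    rw [pow_succ]; noncomm_ring
  calc ‖S ^ j * (T * P)‖ ≤ ‖S ^ (j + 1) * P‖ + ‖S ^ j * (T - S) * P‖ := by
        rw [hsplit]; exact norm_add_le _ _
    _ ≤ B + ‖S ^ j‖ * ‖T - S‖ * ‖P‖ := by
        gcongr
        · exact hP _
        · exact norm_mul₃_le
    _ ≤ B + C * ‖T - S‖ * B := by
        gcongr
        exact hpow j
    _ = B * (C * ‖T - S‖ + 1) := by ring
    _ ≤ B * Real.exp (C * ‖T - S‖) := by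
        gcongr
        exact Real.add_one_le_exp _

theorem norm_pow_mul_prodFrom_le {n : ℕ} {S : Matrix (Fin n) (Fin n) ℝ}
    {T : ℕ → Matrix (Fin n) (Fin n) ℝ} {C : ℝ} (hpow : ∀ m : ℕ, ‖S ^ m‖ ≤ C) (k m j : ℕ) :
    ‖S ^ j * prodFrom T k m‖ ≤
      C * Real.exp (C * ∑ i ∈ Finset.range (m + 1), ‖T (k + i) - S‖) := by
  induction m generalizing j with
  | zero =>
    have h := norm_pow_mul_mul_le_mul_exp (T := T k) (P := 1) hpow
      (fun i => by simpa using hpow i) j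
    simpa [prodFrom] using h
  | succ m ih =>
    rw [Finset.sum_range_succ, mul_add, Real.exp_add, ← mul_assoc]
    exact norm_pow_mul_mul_le_mul_exp hpow ih j

/-- Stability of the perturbed subdivision process.  If the powers of `S`
are uniformly bounded, `‖S^m‖ ≤ C₀`, and `Σ_k ‖S_k − S‖ < ∞`, then the products
`S_{k+m} ⋯ S_{k+1} S_k` are uniformly bounded. -/
theorem perturbed_products_bounded (n : ℕ)
    (S : Matrix (Fin n) (Fin n) ℝ) (T : ℕ → Matrix (Fin n) (Fin n) ℝ)
    (C₀ : ℝ) (hC₀ : 0 < C₀) (hpow : ∀ m : ℕ, ‖S ^ m‖ ≤ C₀)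
    (hsum : Summable fun k : ℕ => ‖T k - S‖) :
    ∃ K > (0 : ℝ), ∀ k m : ℕ, ‖prodFrom T k m‖ ≤ K := by
  refine ⟨C₀ * Real.exp (C₀ * ∑' i, ‖T i - S‖), by positivity, fun k m => ?_⟩
  have hle : ∑ i ∈ Finset.range (m + 1), ‖T (k + i) - S‖ ≤ ∑' i, ‖T i - S‖ := by
    rw [← Finset.sum_image (f := fun i => ‖T i - S‖) (add_right_injective k).injOn]
    exact hsum.sum_le_tsum _ fun i _ => norm_nonneg _
  calc ‖prodFrom T k m‖ = ‖S ^ 0 * prodFrom T k m‖ := by rw [pow_zero, one_mul]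
    _ ≤ C₀ * Real.exp (C₀ * ∑ i ∈ Finset.range (m + 1), ‖T (k + i) - S‖) :=
        norm_pow_mul_prodFrom_le hpow k m 0
    _ ≤ C₀ * Real.exp (C₀ * ∑' i, ‖T i - S‖) := by gcongr
end
end

section
/- Convergence of the PN-subdivided control nets to a central point (convergence part of Theorem 3 together with the mesh-convergence part of Theorem 4): let S be a real n×n matrix whose powers converge, lim_{m→∞} S^m = 𝟙 w₀ᵀ, where 𝟙 ∈ ℝⁿ is the all-ones vector and w₀ ∈ ℝⁿ (as holds for a standard subdivision matrix, which has the simple dominant eigenvalue 1 with right eigenvector 𝟙 and all other eigenvalues of modulus strictly less than 1). Let S_k (k ∈ ℕ) be real n×n matrices with ‖S_k − S‖ ≤ c γ^k for constants c > 0 and 0 < γ < 1. Then for every initial data Q = (q_0; …; q_{n−1}) with q_i ∈ ℝ^d, the sequence Q_m = S_{m−1} ⋯ S_1 S_0 Q converges as m → ∞, and its limit is of the form p_c 𝟙 for a single point p_c ∈ ℝ^d, i.e. every component of Q_m converges to the same point p_c. -/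
open scoped BigOperators

/- Matrices are equipped with the `L∞` operator norm
`‖M‖ = max_i Σ_j |M i j|`, a submultiplicative operator norm. -/
attribute [local instance] Matrix.linftyOpNormedRing Matrix.linftyOpNormedAddCommGroup

noncomputable section

/-- A matrix acts on a column of points `q_i ∈ ℝ^d` componentwise:
`(SQ)_i = Σ_j S_{ij} q_j`. -/
def matAct {n d : ℕ} (S : Matrix (Fin n) (Fin n) ℝ)
    (Q : Fin n → EuclideanSpace ℝ (Fin d)) : Fin n → EuclideanSpace ℝ (Fin d) :=
  fun i => ∑ j : Fin n, S i j • Q j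

/-- The PN-subdivided control nets `Q_m = S_{m-1} ⋯ S_1 S_0 Q`. -/
def netSeq {n d : ℕ} (T : ℕ → Matrix (Fin n) (Fin n) ℝ)
    (Q : Fin n → EuclideanSpace ℝ (Fin d)) : ℕ → Fin n → EuclideanSpace ℝ (Fin d)
  | 0 => Q
  | m + 1 => matAct (T m) (netSeq T Q m)

theorem pow_mul_add_sum_of_succ_eq_mul {R : Type*} [Ring R] {S : R} {T X : ℕ → R}
    (hX : ∀ m, X (m + 1) = T m * X m) (k m : ℕ) :
    X (k + m) = S ^ m * X k +
      ∑ i ∈ Finset.range m, S ^ (m - 1 - i) * ((T (k + i) - S) * X (k + i)) := by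
  induction m with
  | zero => simp
  | succ m ih =>
    have hsum : ∑ i ∈ Finset.range m, S ^ (m - i) * ((T (k + i) - S) * X (k + i)) =
        S * ∑ i ∈ Finset.range m, S ^ (m - 1 - i) * ((T (k + i) - S) * X (k + i)) := by
      rw [Finset.mul_sum]
      refine Finset.sum_congr rfl fun i hi => ?_
      have hi' : m - i = (m - 1 - i) + 1 := by
        have := Finset.mem_range.mp hi
        omega
      rw [hi', pow_succ', mul_assoc]
    rw [Finset.sum_range_succ, Nat.add_sub_cancel, hsum, ← add_assoc, hX, pow_succ', mul_assoc,
      ← add_assoc, ← mul_add, ← ih, Nat.sub_self, pow_zero, one_mul, sub_mul]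
    abel

/-- Discrete Grönwall inequality in integral form. -/
theorem le_mul_exp_sum_of_le_add_sum {u a : ℕ → ℝ} {K : ℝ} (ha : ∀ m, 0 ≤ a m)
    (hu : ∀ m, 0 ≤ u m) (h : ∀ m, u m ≤ K + ∑ i ∈ Finset.range m, a i * u i) (m : ℕ) :
    u m ≤ K * Real.exp (∑ i ∈ Finset.range m, a i) := by
  refine (h m).trans ?_
  induction m with
  | zero => simp
  | succ m ih =>
    rw [Finset.sum_range_succ, Finset.sum_range_succ, Real.exp_add]
    have h1 : 0 ≤ K + ∑ i ∈ Finset.range m, a i * u i := (hu m).trans (h m)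
    have h2 : 1 + a m ≤ Real.exp (a m) := by linarith [Real.add_one_le_exp (a m)]
    calc K + (∑ i ∈ Finset.range m, a i * u i + a m * u m)
        ≤ (K + ∑ i ∈ Finset.range m, a i * u i) * (1 + a m) := by
          nlinarith [mul_le_mul_of_nonneg_left (h m) (ha m)]
      _ ≤ (K + ∑ i ∈ Finset.range m, a i * u i) * Real.exp (a m) := by gcongr
      _ ≤ K * Real.exp (∑ i ∈ Finset.range m, a i) * Real.exp (a m) := by gcongr
      _ = _ := mul_assoc _ _ _

section PerturbedProduct

variable {R : Type*} [NormedRing R] {S : R} {T X : ℕ → R} {c γ K : ℝ}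

theorem sum_range_geometric_shift_le (hc : 0 ≤ c) (hγ₀ : 0 ≤ γ) (hγ₁ : γ < 1) (k m : ℕ) :
    ∑ i ∈ Finset.range m, c * γ ^ (k + i) ≤ c * γ ^ k * (1 - γ)⁻¹ := by
  simp_rw [pow_add, ← mul_assoc]
  rw [← Finset.mul_sum, ← tsum_geometric_of_lt_one hγ₀ hγ₁]
  gcongr
  exact (summable_geometric_of_lt_one hγ₀ hγ₁).sum_le_tsum _ fun i _ => by positivity

theorem norm_sub_pow_mul_le_sum (hK : ∀ m, ‖S ^ m‖ ≤ K) (hT : ∀ k, ‖T k - S‖ ≤ c * γ ^ k)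
    (hX : ∀ m, X (m + 1) = T m * X m) (k m : ℕ) :
    ‖X (k + m) - S ^ m * X k‖ ≤
      ∑ i ∈ Finset.range m, K * (c * γ ^ (k + i)) * ‖X (k + i)‖ := by
  have hK0 : 0 ≤ K := (norm_nonneg _).trans (hK 0)
  rw [pow_mul_add_sum_of_succ_eq_mul (S := S) hX k m, add_sub_cancel_left]
  refine norm_sum_le_of_le _ fun i _ => ?_
  calc ‖S ^ (m - 1 - i) * ((T (k + i) - S) * X (k + i))‖
      ≤ ‖S ^ (m - 1 - i)‖ * (‖T (k + i) - S‖ * ‖X (k + i)‖) :=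
        (norm_mul_le _ _).trans (by gcongr; exact norm_mul_le _ _)
    _ ≤ K * (c * γ ^ (k + i) * ‖X (k + i)‖) := by
        gcongr
        · exact hK _
        · exact hT _
    _ = _ := (mul_assoc _ _ _).symm

theorem exists_norm_le_of_succ_eq_mul (hc : 0 ≤ c) (hγ₀ : 0 ≤ γ) (hγ₁ : γ < 1)
    (hK : ∀ m, ‖S ^ m‖ ≤ K) (hT : ∀ k, ‖T k - S‖ ≤ c * γ ^ k)
    (hX : ∀ m, X (m + 1) = T m * X m) : ∃ B, ∀ m, ‖X m‖ ≤ B := by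
  have hK0 : 0 ≤ K := (norm_nonneg _).trans (hK 0)
  refine ⟨K * ‖X 0‖ * Real.exp (K * c * γ ^ 0 * (1 - γ)⁻¹), fun m => ?_⟩
  refine (le_mul_exp_sum_of_le_add_sum (u := fun m => ‖X m‖)
    (a := fun i => K * c * γ ^ (0 + i)) (K := K * ‖X 0‖) (fun i => by positivity)
    (fun i => norm_nonneg _) (fun m => ?_) m).trans ?_
  · have h := norm_sub_pow_mul_le_sum hK hT hX 0 m
    have h1 : ‖S ^ m * X 0‖ ≤ K * ‖X 0‖ := (norm_mul_le _ _).trans (by gcongr; exact hK m)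
    have h2 := norm_le_norm_add_norm_sub' (X m) (S ^ m * X 0)
    simp only [zero_add, ← mul_assoc] at h ⊢
    linarith
  · gcongr
    exact sum_range_geometric_shift_le (mul_nonneg hK0 hc) hγ₀ hγ₁ 0 m

/-- Left products of geometrically small perturbations of `S` converge when the powers of `S` do,
and the limit is fixed by `lim S ^ m`. -/
theorem exists_tendsto_of_tendsto_pow [CompleteSpace R] {P : R}
    (hS : Filter.Tendsto (fun m : ℕ => S ^ m) Filter.atTop (nhds P))
    (hc : 0 ≤ c) (hγ₀ : 0 ≤ γ) (hγ₁ : γ < 1) (hT : ∀ k, ‖T k - S‖ ≤ c * γ ^ k)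
    (hX : ∀ m, X (m + 1) = T m * X m) :
    ∃ L, Filter.Tendsto X Filter.atTop (nhds L) ∧ P * L = L := by
  obtain ⟨K, hK'⟩ := (Metric.isBounded_range_of_tendsto _ hS).exists_norm_le
  have hK : ∀ m, ‖S ^ m‖ ≤ K := fun m => hK' _ ⟨m, rfl⟩
  have hK0 : 0 ≤ K := (norm_nonneg _).trans (hK 0)
  obtain ⟨B, hB⟩ := exists_norm_le_of_succ_eq_mul hc hγ₀ hγ₁ hK hT hX
  have hB0 : 0 ≤ B := (norm_nonneg _).trans (hB 0)
  have hclose : ∀ k m, ‖X (k + m) - S ^ m * X k‖ ≤ K * B * c * γ ^ k * (1 - γ)⁻¹ := by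
    intro k m
    refine (norm_sub_pow_mul_le_sum hK hT hX k m).trans (le_trans ?_
      (sum_range_geometric_shift_le (c := K * B * c) (by positivity) hγ₀ hγ₁ k m))
    refine Finset.sum_le_sum fun i _ => ?_
    calc K * (c * γ ^ (k + i)) * ‖X (k + i)‖ ≤ K * (c * γ ^ (k + i)) * B := by
          gcongr
          exact hB _
      _ = _ := by ring
  have hsmall : Filter.Tendsto (fun k : ℕ => K * B * c * γ ^ k * (1 - γ)⁻¹)
      Filter.atTop (nhds 0) := by
    simpa using ((tendsto_pow_atTop_nhds_zero_of_lt_one hγ₀ hγ₁).const_mul (K * B * c)).mul_const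
      (1 - γ)⁻¹
  have hpow : ∀ k, Filter.Tendsto (fun m => S ^ m * X k) Filter.atTop (nhds (P * X k)) :=
    fun k => hS.mul_const _
  have hcauchy : CauchySeq X := by
    refine Metric.cauchySeq_iff'.mpr fun ε hε => ?_
    obtain ⟨k, hk⟩ := (hsmall.eventually_lt_const (by positivity : (0 : ℝ) < ε / 4)).exists
    obtain ⟨N, hN⟩ := Metric.tendsto_atTop.mp (hpow k) (ε / 4) (by positivity)
    have hnear : ∀ m ≥ N, dist (X (k + m)) (P * X k) < ε / 2 := fun m hm => by
      have h1 : dist (X (k + m)) (S ^ m * X k) < ε / 4 := by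
        rw [dist_eq_norm]
        exact (hclose k m).trans_lt hk
      linarith [hN m hm, dist_triangle (X (k + m)) (S ^ m * X k) (P * X k)]
    refine ⟨k + N, fun n hn => ?_⟩
    obtain ⟨m, rfl⟩ := Nat.exists_eq_add_of_le (show k ≤ n by omega)
    linarith [hnear m (by omega), hnear N le_rfl,
      dist_triangle_right (X (k + m)) (X (k + N)) (P * X k)]
  obtain ⟨L, hL⟩ := cauchySeq_tendsto_of_complete hcauchy
  refine ⟨L, hL, ?_⟩
  have hdist : ∀ k, ‖L - P * X k‖ ≤ K * B * c * γ ^ k * (1 - γ)⁻¹ := fun k => by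
    have hshift : Filter.Tendsto (fun m => X (k + m)) Filter.atTop (nhds L) := by
      simpa only [add_comm k, Function.comp_def] using hL.comp (Filter.tendsto_add_atTop_nat k)
    exact le_of_tendsto (hshift.sub (hpow k)).norm (Filter.Eventually.of_forall (hclose k))
  have hzero : Filter.Tendsto (fun k => L - P * X k) Filter.atTop (nhds 0) :=
    squeeze_zero_norm hdist hsmall
  have := tendsto_nhds_unique hzero ((hL.const_mul P).const_sub L)
  exact (sub_eq_zero.mp this.symm).symm

end PerturbedProduct

/-- The matrix products `T (m - 1) * ⋯ * T 0`. -/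
def leftProd {n : ℕ} (T : ℕ → Matrix (Fin n) (Fin n) ℝ) : ℕ → Matrix (Fin n) (Fin n) ℝ
  | 0 => 1
  | m + 1 => T m * leftProd T m

theorem matAct_mul {n d : ℕ} (A B : Matrix (Fin n) (Fin n) ℝ)
    (Q : Fin n → EuclideanSpace ℝ (Fin d)) : matAct (A * B) Q = matAct A (matAct B Q) := by
  ext1 i
  simp only [matAct, Matrix.mul_apply, Finset.sum_smul, Finset.smul_sum, smul_smul]
  exact Finset.sum_comm

theorem netSeq_eq_matAct_leftProd {n d : ℕ} (T : ℕ → Matrix (Fin n) (Fin n) ℝ)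
    (Q : Fin n → EuclideanSpace ℝ (Fin d)) (m : ℕ) :
    netSeq T Q m = matAct (leftProd T m) Q := by
  induction m with
  | zero =>
    ext1 i
    simp [netSeq, leftProd, matAct, Matrix.one_apply]
  | succ m ih => rw [netSeq, leftProd, matAct_mul, ih]

/-- Convergence of the PN-subdivided control nets to a central point.
If `S^m → 𝟙w₀ᵀ` (as for a standard subdivision matrix) and `‖S_k − S‖ ≤ c γ^k` with
`0 < γ < 1`, then for every initial net `Q` the nets `Q_m = S_{m-1}⋯S_0 Q` converge
and every component of `Q_m` tends to one single point `p_c`. -/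
theorem pn_nets_converge_to_central_point (n d : ℕ)
    (S : Matrix (Fin n) (Fin n) ℝ) (w₀ : Fin n → ℝ)
    (hS : Filter.Tendsto (fun m : ℕ => S ^ m) Filter.atTop
      (nhds (Matrix.vecMulVec (fun _ => (1 : ℝ)) w₀)))
    (T : ℕ → Matrix (Fin n) (Fin n) ℝ)
    (c γ : ℝ) (hc : 0 < c) (hγ₀ : 0 < γ) (hγ₁ : γ < 1)
    (hT : ∀ k : ℕ, ‖T k - S‖ ≤ c * γ ^ k)
    (Q : Fin n → EuclideanSpace ℝ (Fin d)) :
    ∃ p_c : EuclideanSpace ℝ (Fin d), ∀ i : Fin n,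
      Filter.Tendsto (fun m : ℕ => netSeq T Q m i) Filter.atTop (nhds p_c) := by
  let _ : NormedSpace ℝ (Matrix (Fin n) (Fin n) ℝ) := Matrix.linftyOpNormedSpace
  have := FiniteDimensional.complete ℝ (Matrix (Fin n) (Fin n) ℝ)
  obtain ⟨L, hL, hPL⟩ := exists_tendsto_of_tendsto_pow (X := leftProd T) hS hc.le hγ₀.le hγ₁ hT
    fun _ => rfl
  refine ⟨∑ j, (Matrix.vecMul w₀ L) j • Q j, fun i => ?_⟩
  have hrow : ∀ j, L i j = Matrix.vecMul w₀ L j := fun j => by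
    conv_lhs => rw [← hPL]
    simp [Matrix.mul_apply, Matrix.vecMulVec_apply, Matrix.vecMul, dotProduct]
  simp_rw [netSeq_eq_matAct_leftProd, matAct, ← hrow]
  exact tendsto_finsetSum _ fun j _ =>
    (((continuous_apply_apply i j).tendsto L).comp hL).smul_const (Q j)
end
end

section
/- Difference bounds for the PN perturbation matrices (Lemma 1): let a : ℤ → ℝ be a finitely supported mask whose symbol factors as a(z) = ((1+z)/2)^m b(z) for some finitely supported mask b : ℤ → ℝ, i.e. a_i = 2^{−m} Σ_{r=0}^{m} binom(m,r) b_{i−r} for all i ∈ ℤ. Let A_{ij}^k (i, j ∈ ℤ, k ∈ ℕ) be linear maps on ℝ^d such that for all integers s₁, s₂ ≥ 0 with s₁ + s₂ ≤ m, all k ∈ ℕ, all i, j ∈ ℤ and all l with a_{i−2l} ≠ 0, the mixed backward differences satisfy ‖Δ₁^{s₁} Δ₂^{s₂} (A_{ij}^k − A_{il}^k)‖ ≤ c_s 2^{−(s₁+s₂)k} γ^k, where c_s > 0 and 0 < γ < 1 are constants, Δ₁ differences in the index i and Δ₂ differences in the index j (with l held fixed). Define M_{ij}^k = I + Σ_{l∈ℤ}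 a_{i−2l}(A_{ij}^k − A_{il}^k). Then there exists a constant c_m > 0 such that for all nonnegative integers m₁, m₂ with 1 ≤ m₁ + m₂ ≤ m, and all i, j ∈ ℤ, k ∈ ℕ, ‖Δ₁^{m₁} Δ₂^{m₂} M_{ij}^k‖ ≤ c_m 2^{−(m₁+m₂)k} γ^k. -/
open scoped RealInnerProductSpace BigOperators

noncomputable section

/-- Backward partial difference in the first index: `(Δ₁ X)_{ij} = X_{ij} − X_{i-1,j}`. -/
def D1 {L : Type*} [AddCommGroup L] (X : ℤ → ℤ → L) : ℤ → ℤ → L :=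
  fun i j => X i j - X (i - 1) j

/-- Backward partial difference in the second index: `(Δ₂ X)_{ij} = X_{ij} − X_{i,j-1}`. -/
def D2 {L : Type*} [AddCommGroup L] (X : ℤ → ℤ → L) : ℤ → ℤ → L :=
  fun i j => X i j - X i (j - 1)

variable {d : ℕ}

/-- The PN perturbation matrices `M_{ij}^k = I + Σ_l a_{i−2l}(A_{ij}^k − A_{il}^k)`. -/
def pnMgen (a : ℤ → ℝ)
    (A : ℕ → ℤ → ℤ → (EuclideanSpace ℝ (Fin d) →L[ℝ] EuclideanSpace ℝ (Fin d)))
    (k : ℕ) (i j : ℤ) : EuclideanSpace ℝ (Fin d) →L[ℝ] EuclideanSpace ℝ (Fin d) :=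
  1 + ∑ᶠ l : ℤ, a (i - 2 * l) • (A k i j - A k i l)

/-! ### Backward differences -/

section Differences

variable {V : Type*} [AddCommGroup V]

/-- Backward difference of a sequence indexed by `ℤ`, as an additive map. -/
def backwardDiff : (ℤ → V) →+ (ℤ → V) where
  toFun f i := f i - f (i - 1)
  map_zero' := by ext; simp
  map_add' f g := by ext; simp only [Pi.add_apply]; abel

theorem iterate_D1_apply (n : ℕ) (X : ℤ → ℤ → V) (i j : ℤ) :
    D1^[n] X i j = backwardDiff^[n] (fun i' => X i' j) i := by
  induction n generalizing X with
  | zero => rfl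
  | succ n ih => rw [Function.iterate_succ_apply, Function.iterate_succ_apply, ih]; rfl

theorem D1_D2_commute : Function.Commute (D1 : (ℤ → ℤ → V) → _) D2 := by
  intro X
  ext i j
  simp only [D1, D2]
  abel

theorem D1_neg_commute : Function.Commute (D1 : (ℤ → ℤ → V) → _) Neg.neg := by
  intro X
  ext i j
  simp only [D1, Pi.neg_apply]
  abel

theorem D2_neg_commute : Function.Commute (D2 : (ℤ → ℤ → V) → _) Neg.neg := by
  intro X
  ext i j
  simp only [D2, Pi.neg_apply]
  abel

theorem iterate_D1_zero (n : ℕ) : D1^[n] (0 : ℤ → ℤ → V) = 0 :=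
  Function.iterate_fixed (by ext; simp [D1]) n

theorem iterate_D2_zero (n : ℕ) : D2^[n] (0 : ℤ → ℤ → V) = 0 :=
  Function.iterate_fixed (by ext; simp [D2]) n

theorem iterate_D1_D2_shift (s t : ℕ) (X : ℤ → ℤ → V) (i j : ℤ) :
    D1^[s] (D2^[t] (fun i' j' => X (i' - 1) j')) i j = D1^[s] (D2^[t] X) (i - 1) j := by
  let shift : (ℤ → ℤ → V) → ℤ → ℤ → V := fun Y i' j' => Y (i' - 1) j'
  have h1 : Function.Commute D1 shift := fun _ => rfl
  have h2 : Function.Commute D2 shift := fun _ => rfl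
  change D1^[s] (D2^[t] (shift X)) i j = shift (D1^[s] (D2^[t] X)) i j
  rw [h2.iterate_left t X, h1.iterate_left s]

/-- Differences in the second index do not see a summand independent of that index. -/
theorem iterate_D2_sub_const {t : ℕ} (ht : t ≠ 0) (X : ℤ → ℤ → V) (Z : ℤ → V) :
    D2^[t] (fun i j => X i j - Z i) = D2^[t] X := by
  obtain ⟨t, rfl⟩ := Nat.exists_eq_succ_of_ne_zero ht
  rw [Function.iterate_succ_apply, Function.iterate_succ_apply]
  congr 1
  ext i j
  simp [D2]

theorem iterate_D1_D2_const_sub (s : ℕ) {t : ℕ} (ht : t ≠ 0) (X : ℤ → ℤ → V) (Z : ℤ → V) :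
    D1^[s] (D2^[t] (fun i j => Z i - X i j)) = -D1^[s] (D2^[t] X) := by
  have h : (fun i j => Z i - X i j) = -(fun i j => X i j - Z i) := by ext; simp
  rw [h, D2_neg_commute.iterate_left t, D1_neg_commute.iterate_left s,
    iterate_D2_sub_const ht]

theorem iterate_D1_D2_const_add {s t : ℕ} (h : 1 ≤ s + t) (X : ℤ → ℤ → V) (v : V) :
    D1^[s] (D2^[t] (fun i j => v + X i j)) = D1^[s] (D2^[t] X) := by
  rcases Nat.eq_zero_or_pos t with rfl | ht
  · obtain ⟨s, rfl⟩ := Nat.exists_eq_succ_of_ne_zero (show s ≠ 0 by omega)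
    simp only [Function.iterate_zero, id_eq, Function.iterate_succ_apply]
    congr 1
    ext i j
    simp [D1]
  · rw [← iterate_D2_sub_const ht.ne' (fun i j => v + X i j) (fun _ => v)]
    simp

end Differences

theorem norm_iterate_D1_D2_le {V : Type*} [NormedAddCommGroup V] (s t : ℕ) {X : ℤ → ℤ → V}
    {K : ℝ} (h : ∀ i j, ‖X i j‖ ≤ K) (i j : ℤ) :
    ‖D1^[s] (D2^[t] X) i j‖ ≤ 2 ^ (s + t) * K := by
  induction s generalizing i j with
  | zero =>
    induction t generalizing i j with
    | zero => simpa using h i j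
    | succ t ih =>
      rw [Function.iterate_zero_apply, Function.iterate_succ_apply']
      refine (norm_sub_le _ _).trans ((add_le_add (ih i j) (ih i (j - 1))).trans_eq ?_)
      ring
  | succ s ih =>
    rw [Function.iterate_succ_apply']
    refine (norm_sub_le _ _).trans ((add_le_add (ih i j) (ih (i - 1) j)).trans_eq ?_)
    ring

/-! ### Masks -/

/-- The shift `(S c)_i = c_{i-1}`, i.e. multiplication of the symbol by `z`. -/
def maskShift : Module.End ℝ (ℤ →₀ ℝ) :=
  (Finsupp.domLCongr (Equiv.addRight (1 : ℤ))).toLinearMap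

theorem maskShift_apply (c : ℤ →₀ ℝ) (i : ℤ) : maskShift c i = c (i - 1) := by
  simp [maskShift, Finsupp.domLCongr_apply, sub_eq_add_neg]

theorem maskShift_pow_apply (r : ℕ) (c : ℤ →₀ ℝ) (i : ℤ) :
    (maskShift ^ r) c i = c (i - r) := by
  induction r generalizing i with
  | zero => simp
  | succ r ih =>
    rw [pow_succ', Module.End.mul_apply, maskShift_apply, ih]
    congr 1
    push_cast
    ring

theorem one_add_maskShift_pow_apply (n : ℕ) (c : ℤ →₀ ℝ) (i : ℤ) :
    ((1 + maskShift) ^ n) c i = ∑ r ∈ Finset.range (n + 1), (n.choose r : ℝ) * c (i - r) := by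
  rw [add_comm, (Commute.one_right maskShift).add_pow, LinearMap.sum_apply, Finsupp.finsetSum_apply]
  refine Finset.sum_congr rfl fun r _ => ?_
  rw [one_pow, mul_one, ← nsmul_eq_mul', LinearMap.smul_apply, Finsupp.smul_apply,
    maskShift_pow_apply, nsmul_eq_mul]

/-- Multiplying a mask by an alternating sign replaces its symbol `c(z)` by `± c(-z)`. -/
theorem one_sub_maskShift_pow_smul {u : ℤ → ℝ} (hu : ∀ i, u i = -u (i - 1)) (n : ℕ)
    (c : ℤ →₀ ℝ) :
    ((1 - maskShift) ^ n) (u • c) = u • ((1 + maskShift) ^ n) c := by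
  induction n with
  | zero => simp
  | succ n ih =>
    rw [pow_succ', pow_succ', Module.End.mul_apply, Module.End.mul_apply, ih]
    ext i
    simp only [LinearMap.sub_apply, LinearMap.add_apply, Module.End.one_apply, Finsupp.sub_apply,
      Finsupp.add_apply, maskShift_apply, Finsupp.coe_pointwise_smul, Pi.smul_apply', smul_eq_mul]
    rw [hu i]
    ring

/-- An element divisible by the coprime operators `(1 + f)^n` and `(1 - f)^n` is divisible by
their product. -/
theorem exists_eq_one_sub_sq_pow_apply {W : Type*} [AddCommGroup W] [Module ℝ W]
    (f : Module.End ℝ W) (n : ℕ) {x y z : W} (hy : x = ((1 + f) ^ n) y)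
    (hz : x = ((1 - f) ^ n) z) : ∃ w, x = ((1 - f ^ 2 : Module.End ℝ W) ^ n) w := by
  have h : IsCoprime (1 + Polynomial.X : Polynomial ℝ) (1 - Polynomial.X) := by
    refine ⟨Polynomial.C 2⁻¹, Polynomial.C 2⁻¹, ?_⟩
    rw [← mul_add, show (1 + Polynomial.X + (1 - Polynomial.X) : Polynomial ℝ) = Polynomial.C 2 by
      rw [map_ofNat]; ring, ← map_mul]
    norm_num
  obtain ⟨p, q, hpq⟩ := h.pow (m := n) (n := n)
  refine ⟨Polynomial.aeval f p z + Polynomial.aeval f q y, ?_⟩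
  have e1 : p * (1 + Polynomial.X) ^ n * (1 - Polynomial.X) ^ n
      = (1 - Polynomial.X ^ 2) ^ n * p := by
    rw [mul_assoc, ← mul_pow, mul_comm]; congr 2; ring
  have e2 : q * (1 - Polynomial.X) ^ n * (1 + Polynomial.X) ^ n
      = (1 - Polynomial.X ^ 2) ^ n * q := by
    rw [mul_assoc, ← mul_pow, mul_comm]; congr 2; ring
  replace e1 := congrArg (fun r => Polynomial.aeval f r z) e1
  replace e2 := congrArg (fun r => Polynomial.aeval f r y) e2
  replace hpq := congrArg (fun r => Polynomial.aeval f r x) hpq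
  simp only [map_add, map_sub, map_mul, map_pow, map_one, Polynomial.aeval_X,
    Module.End.mul_apply, LinearMap.add_apply, Module.End.one_apply] at e1 e2 hpq
  rw [map_add, ← e1, ← e2, ← hy, ← hz, hpq]

/-! ### Row sums -/

section RowSum

variable {V : Type*} [NormedAddCommGroup V] [NormedSpace ℝ V]

/-- The action `i ↦ ∑ₗ c_{i-2l} X_{il}` of a binary subdivision mask on the rows of `X`. -/
def rowSum (c : ℤ →₀ ℝ) (X : ℤ → ℤ → V) (i : ℤ) : V :=
  ∑ᶠ l : ℤ, c (i - 2 * l) • X i l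

theorem injective_sub_two_mul (i : ℤ) : Function.Injective fun l : ℤ => i - 2 * l := by
  intro l l' h
  simp only at h
  omega

theorem finite_support_mask_smul_s14 (c : ℤ →₀ ℝ) (i : ℤ) (Y : ℤ → V) :
    (Function.support fun l : ℤ => c (i - 2 * l) • Y l).Finite := by
  refine (c.hasFiniteSupport.preimage (injective_sub_two_mul i).injOn).subset fun l hl => ?_
  exact fun h => hl (by simp [h])

theorem finsum_mask_smul_sub (c : ℤ →₀ ℝ) (i : ℤ) (Y Z : ℤ → V) :
    ∑ᶠ l : ℤ, c (i - 2 * l) • (Y l - Z l)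
      = ∑ᶠ l : ℤ, c (i - 2 * l) • Y l - ∑ᶠ l : ℤ, c (i - 2 * l) • Z l := by
  simp only [smul_sub]
  exact finsum_sub_distrib (finite_support_mask_smul_s14 c i Y) (finite_support_mask_smul_s14 c i Z)

theorem norm_rowSum_le (c : ℤ →₀ ℝ) {X : ℤ → ℤ → V} {K : ℝ} (hK : 0 ≤ K) (i : ℤ)
    (h : ∀ l, c (i - 2 * l) ≠ 0 → ‖X i l‖ ≤ K) :
    ‖rowSum c X i‖ ≤ (∑ p ∈ c.support, |c p|) * K := by
  classical
  have hsub : (Function.support fun l : ℤ => c (i - 2 * l) • X i l)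
      ⊆ c.support.preimage _ (injective_sub_two_mul i).injOn := fun l hl => by
    simpa using fun h => hl (by simp [h])
  rw [rowSum, finsum_eq_sum_of_support_subset _ hsub, Finset.sum_mul]
  calc _ ≤ ∑ l ∈ c.support.preimage _ (injective_sub_two_mul i).injOn, |c (i - 2 * l)| * K := by
        refine norm_sum_le_of_le _ fun l hl => ?_
        rw [norm_smul, Real.norm_eq_abs]
        exact mul_le_mul_of_nonneg_left (h l (by simpa using hl)) (abs_nonneg _)
    _ = _ := Finset.sum_preimage' _ _ (injective_sub_two_mul i).injOn fun p => |c p| * K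
    _ ≤ _ := Finset.sum_le_sum_of_subset_of_nonneg (Finset.filter_subset _ _)
        fun _ _ _ => by positivity

/-- Differences in a parameter pass through the sum. -/
theorem iterate_D2_finsum_mask_smul (c : ℤ →₀ ℝ) (n : ℕ) (Y : ℤ → ℤ → ℤ → V) :
    D2^[n] (fun i j => ∑ᶠ l : ℤ, c (i - 2 * l) • Y l i j)
      = fun i j => ∑ᶠ l : ℤ, c (i - 2 * l) • D2^[n] (Y l) i j := by
  induction n generalizing Y with
  | zero => rfl
  | succ n ih =>
    simp only [Function.iterate_succ_apply]
    rw [← ih]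
    congr 1
    ext i j
    exact (finsum_mask_smul_sub c i (fun l => Y l i j) fun l => Y l i (j - 1)).symm

/-- Summation by parts: a factor `1 - z²` of the symbol becomes a difference in the second
index. -/
theorem rowSum_one_sub_sq (c : ℤ →₀ ℝ) (X : ℤ → ℤ → V) :
    rowSum ((1 - maskShift ^ 2 : Module.End ℝ (ℤ →₀ ℝ)) c) X = rowSum c (D2 X) := by
  ext i
  have hshift : ∑ᶠ l : ℤ, c (i - 2 * (l + 1)) • X i l = ∑ᶠ l : ℤ, c (i - 2 * l) • X i (l - 1) := by
    rw [← finsum_comp_equiv (Equiv.addRight (1 : ℤ)) (f := fun l => c (i - 2 * l) • X i (l - 1))]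
    simp
  have hfin : (Function.support fun l : ℤ => c (i - 2 * (l + 1)) • X i l).Finite := by
    convert finite_support_mask_smul_s14 ((maskShift ^ 2) c) i (X i) using 4
    rw [maskShift_pow_apply]
    congr 1
    push_cast
    ring
  simp only [rowSum, D2]
  rw [finsum_mask_smul_sub, ← hshift, ← finsum_sub_distrib (finite_support_mask_smul_s14 c i _) hfin]
  refine finsum_congr fun l => ?_
  rw [← sub_smul, LinearMap.sub_apply, Finsupp.sub_apply, maskShift_pow_apply,
    Module.End.one_apply]
  congr 3
  push_cast
  ring

theorem rowSum_one_sub_sq_pow (n : ℕ) (c : ℤ →₀ ℝ) (X : ℤ → ℤ → V) :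
    rowSum (((1 - maskShift ^ 2 : Module.End ℝ (ℤ →₀ ℝ)) ^ n) c) X = rowSum c (D2^[n] X) := by
  induction n generalizing X with
  | zero => rfl
  | succ n ih =>
    rw [pow_succ', Module.End.mul_apply, rowSum_one_sub_sq, ih, Function.iterate_succ_apply]

/-- Leibniz rule combined with summation by parts. -/
theorem backwardDiff_rowSum (c : ℤ →₀ ℝ) (X : ℤ → ℤ → V) :
    backwardDiff (rowSum ((1 + maskShift) c) X)
      = rowSum ((1 + maskShift) c) (D1 X) + rowSum c (fun i l => D2 X (i - 1) l) := by
  have hfac : (1 - maskShift ^ 2 : Module.End ℝ (ℤ →₀ ℝ)) c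
      = (1 - maskShift) ((1 + maskShift) c) := by
    ext i
    simp only [LinearMap.sub_apply, LinearMap.add_apply, Module.End.one_apply, Finsupp.sub_apply,
      Finsupp.add_apply, sq, Module.End.mul_apply, maskShift_apply]
    ring
  generalize hg : (1 + maskShift) c = g at *
  have h : rowSum c (fun i l => D2 X (i - 1) l) = rowSum ((1 - maskShift) g)
      fun i l => X (i - 1) l := by
    rw [← hfac, rowSum_one_sub_sq]
    rfl
  rw [h]
  ext i
  have hg1 : ∀ l, g (i - 1 - 2 * l) = (maskShift g) (i - 2 * l) := fun l => by
    rw [maskShift_apply]; congr 1; ring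
  change rowSum g X i - rowSum g X (i - 1) = rowSum g (D1 X) i + rowSum _ _ i
  simp only [rowSum, D1, hg1]
  rw [finsum_mask_smul_sub]
  simp only [LinearMap.sub_apply, Finsupp.sub_apply, Module.End.one_apply, sub_smul]
  rw [finsum_sub_distrib (finite_support_mask_smul_s14 g i _) (finite_support_mask_smul_s14 _ i _)]
  abel

/-- If the symbol of a mask is divisible by `(1 + z)^n`, then the `n`-th differences of its row
sums are controlled by the mixed differences of order `n`; the pure `n`-th difference in the first
index is only needed on the support of the mask. -/
theorem exists_norm_iterate_backwardDiff_rowSum_le (n : ℕ) (e : ℤ →₀ ℝ) :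
    ∃ C : ℝ, 0 ≤ C ∧ ∀ (X : ℤ → ℤ → V) (K : ℝ), 0 ≤ K →
      (∀ s t, s + t = n → ∀ i l, (t = 0 → ((1 + maskShift) ^ n) e (i - 2 * l) ≠ 0) →
        ‖D1^[s] (D2^[t] X) i l‖ ≤ K) →
      ∀ i, ‖backwardDiff^[n] (rowSum (((1 + maskShift) ^ n) e) X) i‖ ≤ C * K := by
  induction n generalizing e with
  | zero =>
    refine ⟨∑ p ∈ e.support, |e p|, by positivity, fun X K hK h i => ?_⟩
    exact norm_rowSum_le e hK i fun l hl => h 0 0 rfl i l fun _ => hl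
  | succ n ih =>
    obtain ⟨C₁, hC₁, h₁⟩ := ih ((1 + maskShift) e)
    obtain ⟨C₂, hC₂, h₂⟩ := ih e
    refine ⟨C₁ + C₂, by positivity, fun X K hK h i => ?_⟩
    rw [Function.iterate_succ_apply, pow_succ', Module.End.mul_apply, backwardDiff_rowSum,
      iterate_map_add, add_mul, Pi.add_apply]
    have hcomm : (1 + maskShift) (((1 + maskShift) ^ n) e)
        = ((1 + maskShift) ^ n) ((1 + maskShift) e) := by
      rw [← Module.End.mul_apply, ← Module.End.mul_apply, ← pow_succ, ← pow_succ']
    rw [hcomm]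
    refine norm_add_le_of_le (h₁ _ K hK (fun s t hst i l hl => ?_) i)
      (h₂ _ K hK (fun s t hst i l _ => ?_) i)
    · rw [← D1_D2_commute.iterate_right t X, ← Function.iterate_succ_apply]
      exact h (s + 1) t (by omega) i l (by rwa [pow_succ])
    · rw [iterate_D1_D2_shift, ← Function.iterate_succ_apply]
      exact h s (t + 1) (by omega) (i - 1) l (by simp)

end RowSum

/-! ### The perturbation matrices -/

/-- Difference bounds for the PN perturbation matrices (Lemma 1).
If the symbol of `a` factors as `a(z) = ((1+z)/2)^m b(z)`, and the mixed backward
differences of the families `(i,j) ↦ A_{ij}^k − A_{il}^k` (with `l` fixed, `a_{i−2l} ≠ 0`)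
of orders `s₁ + s₂ ≤ m` are bounded by `c_s 2^{−(s₁+s₂)k} γ^k`, then the mixed
differences of `M_{ij}^k = I + Σ_l a_{i−2l}(A_{ij}^k − A_{il}^k)` of orders
`1 ≤ m₁ + m₂ ≤ m` are bounded by `c_m 2^{−(m₁+m₂)k} γ^k`. -/
theorem pn_M_difference_bounds
    (m : ℕ) (a b : ℤ → ℝ)
    (hb : (Function.support b).Finite)
    (hab : ∀ i : ℤ, a i = (2 : ℝ)⁻¹ ^ m *
      ∑ r ∈ Finset.range (m + 1), (m.choose r : ℝ) * b (i - (r : ℤ)))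
    (A : ℕ → ℤ → ℤ → (EuclideanSpace ℝ (Fin d) →L[ℝ] EuclideanSpace ℝ (Fin d)))
    (c_s γ : ℝ) (hc : 0 < c_s) (hγ₀ : 0 < γ) (hγ₁ : γ < 1)
    (hA : ∀ s₁ s₂ : ℕ, s₁ + s₂ ≤ m → ∀ (k : ℕ) (i j l : ℤ), a (i - 2 * l) ≠ 0 →
      ‖(D1^[s₁] (D2^[s₂] (fun i' j' => A k i' j' - A k i' l))) i j‖
        ≤ c_s * (2 : ℝ)⁻¹ ^ ((s₁ + s₂) * k) * γ ^ k) :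
    ∃ c_m > (0 : ℝ), ∀ m₁ m₂ : ℕ, 1 ≤ m₁ + m₂ → m₁ + m₂ ≤ m →
      ∀ (k : ℕ) (i j : ℤ),
        ‖(D1^[m₁] (D2^[m₂] (fun i' j' => pnMgen a A k i' j'))) i j‖
          ≤ c_m * (2 : ℝ)⁻¹ ^ ((m₁ + m₂) * k) * γ ^ k := by
  let e : ℤ →₀ ℝ := (2 : ℝ)⁻¹ ^ m • Finsupp.ofSupportFinite b hb
  let c : ℤ →₀ ℝ := ((1 + maskShift) ^ m) e
  have hc_apply : ∀ i, c i = a i := fun i => by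
    simp [c, e, one_add_maskShift_pow_apply, hab, Finsupp.ofSupportFinite_coe]
  let X : ℕ → ℕ → ℤ → ℤ → ℤ → (EuclideanSpace ℝ (Fin d) →L[ℝ] EuclideanSpace ℝ (Fin d)) :=
    fun k t j i l => D2^[t] (fun i' j' => A k i' j' - A k i' l) i j
  have hM : ∀ k, (fun i j => pnMgen a A k i j) = fun i j => 1 + rowSum c (X k 0 j) i := fun k => by
    simp only [pnMgen, rowSum, hc_apply]
    rfl
  have hdiff : ∀ m₁ m₂, 1 ≤ m₁ + m₂ → ∀ k i j,
      D1^[m₁] (D2^[m₂] (fun i' j' => pnMgen a A k i' j')) i j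
        = backwardDiff^[m₁] (rowSum c (X k m₂ j)) i := fun m₁ m₂ h k i j => by
    rw [hM, iterate_D1_D2_const_add h, iterate_D1_apply]
    refine congr_fun (congrArg _ (funext fun i' => ?_)) i
    exact congr_fun (congr_fun
      (iterate_D2_finsum_mask_smul c m₂ fun l i j => A k i j - A k i l) i') j
  have hA2 : ∀ s t, t ≠ 0 → s + t ≤ m → ∀ k i l l', a (i - 2 * l') ≠ 0 →
      ‖D1^[s] (D2^[t] (A k)) i l‖ ≤ c_s * (2 : ℝ)⁻¹ ^ ((s + t) * k) * γ ^ k :=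
    fun s t ht hst k i l l' hl' => by
      simpa only [iterate_D2_sub_const ht (A k)] using hA s t hst k i l l' hl'
  by_cases hrow : ∀ i, ∃ l, a (i - 2 * l) ≠ 0
  · have hC : ∀ n, ∃ C : ℝ, 0 ≤ C ∧ (n ≤ m → ∀ (Y : ℤ → ℤ → _) (K : ℝ), 0 ≤ K →
        (∀ s t, s + t = n → ∀ i l, (t = 0 → a (i - 2 * l) ≠ 0) →
          ‖D1^[s] (D2^[t] Y) i l‖ ≤ K) →
        ∀ i, ‖backwardDiff^[n] (rowSum (V := EuclideanSpace ℝ (Fin d) →L[ℝ]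
          EuclideanSpace ℝ (Fin d)) c Y) i‖ ≤ C * K) := fun n => by
      obtain ⟨C, hC, h⟩ := exists_norm_iterate_backwardDiff_rowSum_le
        (V := EuclideanSpace ℝ (Fin d) →L[ℝ] EuclideanSpace ℝ (Fin d)) n
        (((1 + maskShift) ^ (m - n)) e)
      refine ⟨C, hC, fun hn => ?_⟩
      have hcn : ((1 + maskShift) ^ n) (((1 + maskShift) ^ (m - n)) e) = c := by
        rw [← Module.End.mul_apply, ← pow_add, Nat.add_sub_cancel' hn]
      simpa only [hcn, hc_apply] using h
    choose C hC₀ hC using hC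
    have hsum : 0 ≤ ∑ n ∈ Finset.range (m + 1), C n := Finset.sum_nonneg fun n _ => hC₀ n
    refine ⟨(∑ n ∈ Finset.range (m + 1), C n + 1) * c_s, by positivity, fun m₁ m₂ h1 hm k i j => ?_⟩
    have hle : C m₁ ≤ ∑ n ∈ Finset.range (m + 1), C n + 1 :=
      (Finset.single_le_sum (f := C) (fun n _ => hC₀ n)
        (Finset.mem_range.2 (by omega : m₁ < m + 1))).trans (by linarith)
    have hK : 0 ≤ c_s * (2 : ℝ)⁻¹ ^ ((m₁ + m₂) * k) * γ ^ k := by positivity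
    rw [hdiff m₁ m₂ h1 k i j]
    refine (hC m₁ (by omega) _ _ hK (fun s t hst i l hl => ?_) i).trans
      ((mul_le_mul_of_nonneg_right hle hK).trans_eq (by ring))
    rcases eq_or_ne t 0 with rfl | ht
    · obtain rfl : s = m₁ := by omega
      have := hA s m₂ hm k i j l (hl rfl)
      rwa [iterate_D1_apply] at this ⊢
    · rcases eq_or_ne m₂ 0 with rfl | hm₂
      · obtain ⟨l', hl'⟩ := hrow i
        change ‖D1^[s] (D2^[t] (fun i l => A k i j - A k i l)) i l‖ ≤ _
        rw [iterate_D1_D2_const_sub s ht, Pi.neg_apply, Pi.neg_apply, norm_neg, add_zero, ← hst]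
        exact hA2 s t ht (by omega) k i l l' hl'
      · have hX : X k m₂ j = fun i _ => 0 - -D2^[m₂] (A k) i j := by
          ext1 i
          ext1 l
          simp only [X, iterate_D2_sub_const hm₂ (A k), zero_sub, neg_neg]
        have h0 : D2^[t] (X k m₂ j) = 0 := by
          rw [hX, iterate_D2_sub_const ht (fun _ _ => 0)]
          exact iterate_D2_zero t
        rw [h0, iterate_D1_zero]
        simpa using hK
  · push Not at hrow
    obtain ⟨i₀, hi₀⟩ := hrow
    -- `a` lives on one parity class, so its symbol is divisible by `(1 - z²)^m`.
    let u : ℤ → ℝ := fun i => ((i - i₀).negOnePow : ℤ)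
    have hu : ∀ i, u i = -u (i - 1) := fun i => by
      have : i - i₀ = i - 1 - i₀ + 1 := by ring
      simp only [u]
      rw [this, Int.negOnePow_succ]
      simp
    have hcu : c = ((1 - maskShift) ^ m) (u • -e) := by
      rw [one_sub_maskShift_pow_smul hu, map_neg]
      ext i
      simp only [Finsupp.coe_pointwise_smul, Pi.smul_apply', smul_eq_mul, Finsupp.neg_apply]
      change c i = u i * -c i
      rcases Int.even_or_odd (i - i₀) with h | h
      · obtain ⟨r, hr⟩ := h
        have : c i = 0 := by
          rw [hc_apply, ← hi₀ (-r)]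
          congr 1
          omega
        simp [this]
      · simp only [u, Int.negOnePow_odd _ h]
        simp
    obtain ⟨w, hw⟩ := exists_eq_one_sub_sq_pow_apply maskShift m (show c = _ from rfl) hcu
    refine ⟨2 ^ m * (∑ p ∈ w.support, |w p| + 1) * c_s, by positivity, fun m₁ m₂ h1 hm k i j => ?_⟩
    have hm0 : m ≠ 0 := by omega
    have hrowSum : ∀ i j, ‖rowSum c (X k 0 j) i‖ ≤
        (∑ p ∈ w.support, |w p|) * (c_s * (2 : ℝ)⁻¹ ^ (m * k) * γ ^ k) := fun i j => by
      by_cases hi : ∃ l, a (i - 2 * l) ≠ 0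
      · obtain ⟨l', hl'⟩ := hi
        rw [hw, rowSum_one_sub_sq_pow]
        refine norm_rowSum_le w (by positivity) i fun l _ => ?_
        have := iterate_D1_D2_const_sub 0 hm0 (A k) (fun i => A k i j)
        simp only [Function.iterate_zero, id_eq] at this
        change ‖D2^[m] (fun i l => A k i j - A k i l) i l‖ ≤ _
        rw [this, Pi.neg_apply, Pi.neg_apply, norm_neg]
        simpa using hA2 0 m hm0 (by omega) k i l l' hl'
      · push Not at hi
        refine (norm_rowSum_le c le_rfl i fun l hl => absurd ((hc_apply _).trans (hi l)) hl).trans ?_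
        rw [mul_zero]
        positivity
    rw [hM, iterate_D1_D2_const_add h1]
    refine (norm_iterate_D1_D2_le m₁ m₂ hrowSum i j).trans ?_
    have h2 : (2 : ℝ) ^ (m₁ + m₂) ≤ 2 ^ m := pow_le_pow_right₀ (by norm_num) hm
    have h3 : (2 : ℝ)⁻¹ ^ (m * k) ≤ 2⁻¹ ^ ((m₁ + m₂) * k) :=
      pow_le_pow_of_le_one (by norm_num) (by norm_num) (Nat.mul_le_mul_right k hm)
    calc _ ≤ 2 ^ m * ((∑ p ∈ w.support, |w p| + 1)
          * (c_s * (2 : ℝ)⁻¹ ^ ((m₁ + m₂) * k) * γ ^ k)) := by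
          gcongr
          linarith
      _ = _ := by ring
end
end

section
/- Perturbed difference recursion for PN subdivision (key estimate in the proof of Theorem 2): let a : ℤ → ℝ be a finitely supported mask whose symbol factors as a(z) = ((1+z)/2)^m b(z) for a finitely supported mask b : ℤ → ℝ. Let M_{ij}^k (i, j ∈ ℤ, k ∈ ℕ) be linear maps on ℝ^d with M_{ij}^k = I unless |i − 2j| ≤ B, satisfying ‖M_{ij}^k‖ ≤ C and the difference bounds ‖Δ₁^{s₁} Δ₂^{s₂} M_{ij}^k‖ ≤ c_m 2^{−(s₁+s₂)k} γ^k for all 1 ≤ s₁ + s₂ ≤ m, with constants C, c_m > 0 and 0 < γ < 1. Let p^k : ℤ → ℝ^d satisfy p_i^{k+1} = Σ_{j∈ℤ} a_{i−2j} M_{ij}^k p_j^k, and suppose the normalized lower-order differences are uniformly bounded: sup_{i,k} ‖Δ^l p_i^k / 2^{−lk}‖ ≤ K for every 0 ≤ l < m. Then there exist a constant c > 0 and sequences ε^k : ℤ → ℝ^d with ‖ε_i^k‖ ≤ c γ^k such that for all i ∈ ℤ and k ∈ ℕ, Δ^m p_i^{k+1} / 2^{−m(k+1)} = Σ_{j∈ℤ}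 b_{i−2j} M_{ij}^k (Δ^m p_j^k / 2^{−mk}) + ε_i^k. -/
open scoped RealInnerProductSpace BigOperators

noncomputable section

variable {d : ℕ}

/-- Backward difference of a sequence: `(Δ q)_i = q_i − q_{i−1}`. -/
def Dseq {L : Type*} [AddCommGroup L] (q : ℤ → L) : ℤ → L :=
  fun i => q i - q (i - 1)

section Differences

variable {L : Type*} [AddCommGroup L]

theorem Dseq_iterate_add (n : ℕ) (f g : ℤ → L) :
    Dseq^[n] (f + g) = Dseq^[n] f + Dseq^[n] g := by
  induction n generalizing f g with
  | zero => rfl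
  | succ n ih =>
    have h : Dseq (f + g) = Dseq f + Dseq g := by
      funext i
      simp only [Dseq, Pi.add_apply]
      abel
    rw [Function.iterate_succ_apply, Function.iterate_succ_apply, Function.iterate_succ_apply,
      h, ih]

theorem Dseq_iterate_smul [Module ℝ L] (n : ℕ) (t : ℝ) (f : ℤ → L) :
    Dseq^[n] (t • f) = t • Dseq^[n] f := by
  induction n generalizing f with
  | zero => rfl
  | succ n ih =>
    have h : Dseq (t • f) = t • Dseq f := by
      funext i
      simp only [Dseq, Pi.smul_apply, smul_sub]
    rw [Function.iterate_succ_apply, Function.iterate_succ_apply, h, ih]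

theorem Dseq_iterate_shift (n : ℕ) (f : ℤ → L) (i : ℤ) :
    (Dseq^[n] (fun j => f (j - 1))) i = (Dseq^[n] f) (i - 1) := by
  induction n generalizing f with
  | zero => rfl
  | succ n ih => exact ih (Dseq f)

theorem D1_iterate_D2_iterate_D1 (s₁ s₂ : ℕ) (X : ℤ → ℤ → L) :
    D1^[s₁] (D2^[s₂] (D1 X)) = D1^[s₁ + 1] (D2^[s₂] X) := by
  have hcomm : Function.Commute (D1 (L := L)) D2 := by
    intro X
    funext i j
    simp only [D1, D2]
    abel
  rw [Function.iterate_succ_apply, (hcomm.iterate_right s₂).eq]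

end Differences

/-- Multiplication of the symbol of a mask by `(1 + z) / 2`. -/
def maskAverage (β : ℤ → ℝ) : ℤ → ℝ :=
  fun i => 2⁻¹ * (β i + β (i - 1))

theorem maskAverage_iterate_apply (n : ℕ) (β : ℤ → ℝ) (i : ℤ) :
    (maskAverage^[n] β) i
      = (2 : ℝ)⁻¹ ^ n * ∑ r ∈ Finset.range (n + 1), (n.choose r : ℝ) * β (i - (r : ℤ)) := by
  induction n generalizing i with
  | zero => simp
  | succ n ih =>
    rw [Function.iterate_succ_apply', maskAverage, ih, ih, Finset.sum_range_succ' _ (n + 1)]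
    have h₁ : ∑ r ∈ Finset.range (n + 1), (n.choose r : ℝ) * β (i - (r : ℤ))
        = ∑ r ∈ Finset.range (n + 1), (n.choose (r + 1) : ℝ) * β (i - ((r + 1 : ℕ) : ℤ))
          + β i := by
      rw [Finset.sum_range_succ', Finset.sum_range_succ _ n]
      simp
    have h₂ : ∀ r : ℕ, ((n + 1).choose (r + 1) : ℝ) * β (i - ((r + 1 : ℕ) : ℤ))
        = (n.choose r : ℝ) * β (i - 1 - (r : ℤ))
          + (n.choose (r + 1) : ℝ) * β (i - ((r + 1 : ℕ) : ℤ)) := by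
      intro r
      rw [Nat.choose_succ_succ, show i - ((r + 1 : ℕ) : ℤ) = i - 1 - (r : ℤ) by push_cast; ring]
      push_cast
      ring
    simp only [h₂, Finset.sum_add_distrib]
    rw [h₁]
    simp only [Nat.choose_zero_right, Nat.cast_one, Nat.cast_zero, sub_zero, one_mul]
    ring

theorem finite_support_shift {β : ℤ → ℝ} (hβ : (Function.support β).Finite) :
    (Function.support fun i => β (i - 1)).Finite :=
  hβ.preimage (sub_left_injective (b := (1 : ℤ))).injOn

theorem finite_support_maskAverage {β : ℤ → ℝ} (hβ : (Function.support β).Finite) :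
    (Function.support (maskAverage β)).Finite := by
  refine (hβ.union (finite_support_shift hβ)).subset fun i hi => ?_
  by_contra h
  simp only [Set.mem_union, Function.mem_support, not_or, not_not] at h
  exact hi (by simp [maskAverage, h.1, h.2])

theorem finite_support_maskAverage_iterate {β : ℤ → ℝ} (hβ : (Function.support β).Finite)
    (n : ℕ) : (Function.support (maskAverage^[n] β)).Finite := by
  induction n with
  | zero => exact hβ
  | succ n ih =>
    rw [Function.iterate_succ_apply']
    exact finite_support_maskAverage ih

theorem maskAverage_iterate_shift (n : ℕ) (β : ℤ → ℝ) :
    maskAverage^[n] (fun i => β (i - 1)) = fun i => (maskAverage^[n] β) (i - 1) := by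
  induction n generalizing β with
  | zero => rfl
  | succ n ih => exact ih (maskAverage β)

section Subdivision

variable {E : Type*} [NormedAddCommGroup E] [NormedSpace ℝ E]

/-- The subdivision rule with scalar mask `β` and operator weights `X i j`. -/
def subdivide (β : ℤ → ℝ) (X : ℤ → ℤ → (E →L[ℝ] E)) (q : ℤ → E) : ℤ → E :=
  fun i => ∑ᶠ j : ℤ, β (i - 2 * j) • X i j (q j)

theorem finite_preimage_dyadic {β : ℤ → ℝ} (hβ : (Function.support β).Finite) (i : ℤ) :
    ((fun j : ℤ => i - 2 * j) ⁻¹' Function.support β).Finite :=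
  hβ.preimage fun x _ y _ (h : i - 2 * x = i - 2 * y) => by omega

theorem finite_support_smul_dyadic {β : ℤ → ℝ} (hβ : (Function.support β).Finite) (i : ℤ)
    (v : ℤ → E) : (Function.support fun j => β (i - 2 * j) • v j).Finite :=
  (finite_preimage_dyadic hβ i).subset fun j hj h => hj (by simp [h])

theorem Dseq_subdivide_maskAverage {β : ℤ → ℝ} (hβ : (Function.support β).Finite)
    (X : ℤ → ℤ → (E →L[ℝ] E)) (q : ℤ → E) :
    Dseq (subdivide (maskAverage β) X q)
      = (2 : ℝ)⁻¹ • subdivide β X (Dseq q)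
        + ((2 : ℝ)⁻¹ • subdivide β (D2 X) (fun j => q (j - 1))
          + subdivide (fun i => maskAverage β (i - 1)) (D1 X) q) := by
  funext i
  have hfin := fun v : ℤ → E => finite_support_smul_dyadic hβ i v
  have havg := finite_support_maskAverage hβ
  have hreindex : ∑ᶠ j : ℤ, β (i - 2 - 2 * j) • X i j (q j)
      = ∑ᶠ j : ℤ, β (i - 2 * j) • X i (j - 1) (q (j - 1)) := by
    rw [← finsum_comp_equiv (Equiv.subRight (1 : ℤ))]
    refine finsum_congr fun j => ?_
    simp only [Equiv.subRight_apply]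
    rw [show i - 2 - 2 * (j - 1) = i - 2 * j by ring]
  have hfin₂ : (Function.support fun j => β (i - 2 - 2 * j) • X i j (q j)).Finite :=
    finite_support_smul_dyadic hβ (i - 2) _
  have hprev : (Function.support
      fun j => maskAverage β (i - 1 - 2 * j) • X (i - 1) j (q j)).Finite :=
    finite_support_smul_dyadic havg (i - 1) _
  have hprev₂ : (Function.support
      fun j => maskAverage β (i - 1 - 2 * j) • (D1 X) i j (q j)).Finite :=
    finite_support_smul_dyadic havg (i - 1) _
  have hlhs : Dseq (subdivide (maskAverage β) X q) i
      = (2 : ℝ)⁻¹ • (∑ᶠ j : ℤ, β (i - 2 * j) • X i j (q j)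
          - ∑ᶠ j : ℤ, β (i - 2 - 2 * j) • X i j (q j))
        + ∑ᶠ j : ℤ, maskAverage β (i - 1 - 2 * j) • (D1 X) i j (q j) := by
    have hcur := finite_support_smul_dyadic havg i fun j => X i j (q j)
    simp only [Dseq, subdivide]
    rw [← finsum_sub_distrib hcur hprev, ← finsum_sub_distrib (hfin _) hfin₂, smul_finsum,
      ← finsum_add_distrib _ hprev₂]
    · refine finsum_congr fun j => ?_
      simp only [maskAverage, D1, sub_apply, smul_sub, smul_smul, mul_add, add_smul]
      rw [show i - 2 * j - 1 = i - 1 - 2 * j by ring,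
        show i - 1 - 2 * j - 1 = i - 2 - 2 * j by ring]
      abel
    · refine ((hfin fun j => X i j (q j)).union hfin₂).subset fun j hj => ?_
      by_contra h
      simp only [Set.mem_union, Function.mem_support, not_or, not_not] at h
      exact hj (by simp only [h.1, h.2, sub_zero, smul_zero])
  rw [hlhs, hreindex, ← finsum_sub_distrib (hfin _) (hfin _)]
  simp only [Pi.add_apply, Pi.smul_apply, subdivide]
  rw [← add_assoc, ← smul_add, ← finsum_add_distrib (hfin _) (hfin _)]
  congr 1
  · congr 1
    refine finsum_congr fun j => ?_
    simp only [Dseq, D2, sub_apply, map_sub, smul_sub]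
    abel
  · refine finsum_congr fun j => ?_
    rw [show i - 1 - 2 * j = i - 2 * j - 1 by ring]

theorem norm_subdivide_le {β : ℤ → ℝ} (hβ : (Function.support β).Finite)
    (X : ℤ → ℤ → (E →L[ℝ] E)) (q : ℤ → E) {H : ℝ}
    (hH : ∀ i j, ‖X i j‖ * ‖q j‖ ≤ H) (i : ℤ) :
    ‖subdivide β X q i‖ ≤ (∑ t ∈ hβ.toFinset, |β t|) * H := by
  have hH₀ : 0 ≤ H := (by positivity : 0 ≤ ‖X 0 0‖ * ‖q 0‖).trans (hH 0 0)
  have hT := finite_preimage_dyadic hβ i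
  have hsum : subdivide β X q i = ∑ j ∈ hT.toFinset, β (i - 2 * j) • X i j (q j) := by
    refine finsum_eq_sum_of_support_subset _ fun j hj => ?_
    rw [Set.Finite.coe_toFinset]
    exact fun h => hj (by simp [h])
  have hinj : Set.InjOn (fun j : ℤ => i - 2 * j) (hT.toFinset : Set ℤ) :=
    fun x _ y _ (h : i - 2 * x = i - 2 * y) => by omega
  calc ‖subdivide β X q i‖ ≤ ∑ j ∈ hT.toFinset, |β (i - 2 * j)| * H := by
        rw [hsum]
        refine norm_sum_le_of_le _ fun j _ => ?_
        rw [norm_smul, Real.norm_eq_abs]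
        gcongr
        exact ((X i j).le_opNorm _).trans (hH i j)
    _ = (∑ t ∈ hT.toFinset.image (fun j : ℤ => i - 2 * j), |β t|) * H := by
        rw [Finset.sum_image hinj, Finset.sum_mul]
    _ ≤ (∑ t ∈ hβ.toFinset, |β t|) * H := by
        gcongr
        intro t ht
        obtain ⟨j, hj, rfl⟩ := Finset.mem_image.1 ht
        simpa using hj

theorem exists_norm_Dseq_iterate_subdivide_le (n : ℕ) {β : ℤ → ℝ}
    (hβ : (Function.support β).Finite) :
    ∃ A : ℝ, 0 ≤ A ∧ ∀ (X : ℤ → ℤ → (E →L[ℝ] E)) (q : ℤ → E) (H : ℝ),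
      (∀ s₁ s₂ l : ℕ, s₁ + s₂ + l = n → ∀ i j j' : ℤ,
        ‖(D1^[s₁] (D2^[s₂] X)) i j‖ * ‖(Dseq^[l] q) j'‖ ≤ H) →
      ∀ i, ‖(Dseq^[n] (subdivide (maskAverage^[n] β) X q)) i‖ ≤ A * H := by
  induction n generalizing β with
  | zero =>
    exact ⟨∑ t ∈ hβ.toFinset, |β t|, by positivity, fun X q H hH i =>
      norm_subdivide_le hβ X q (fun i j => hH 0 0 0 rfl i j j) i⟩
  | succ n ih =>
    obtain ⟨A₁, hA₁, h₁⟩ := ih hβ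
    obtain ⟨A₂, hA₂, h₂⟩ := ih (finite_support_shift (finite_support_maskAverage hβ))
    refine ⟨2⁻¹ * A₁ + (2⁻¹ * A₁ + A₂), by positivity, fun X q H hH i => ?_⟩
    have e₁ := h₁ X (Dseq q) H (fun s₁ s₂ l h i j j' => by
      simpa only [Function.iterate_succ_apply] using hH s₁ s₂ (l + 1) (by omega) i j j') i
    have e₂ := h₁ (D2 X) (fun j => q (j - 1)) H (fun s₁ s₂ l h i j j' => by
      rw [Dseq_iterate_shift]
      simpa only [Function.iterate_succ_apply] using
        hH s₁ (s₂ + 1) l (by omega) i j (j' - 1)) i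
    have e₃ := h₂ (D1 X) q H (fun s₁ s₂ l h i j j' => by
      rw [D1_iterate_D2_iterate_D1]
      exact hH (s₁ + 1) s₂ l (by omega) i j j') i
    rw [Function.iterate_succ_apply, Function.iterate_succ_apply' maskAverage,
      Dseq_subdivide_maskAverage (finite_support_maskAverage_iterate hβ n),
      Dseq_iterate_add, Dseq_iterate_add, Dseq_iterate_smul, Dseq_iterate_smul]
    rw [maskAverage_iterate_shift, ← Function.iterate_succ_apply,
      Function.iterate_succ_apply'] at e₃
    simp only [Pi.add_apply, Pi.smul_apply]
    refine (norm_add_le_of_le le_rfl (norm_add_le _ _)).trans ?_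
    rw [norm_smul, norm_smul, Real.norm_of_nonneg (by norm_num : (0 : ℝ) ≤ 2⁻¹)]
    linarith

theorem exists_norm_Dseq_iterate_subdivide_sub_le (n : ℕ) {β : ℤ → ℝ}
    (hβ : (Function.support β).Finite) :
    ∃ A : ℝ, 0 ≤ A ∧ ∀ (X : ℤ → ℤ → (E →L[ℝ] E)) (q : ℤ → E) (H : ℝ), 0 ≤ H →
      (∀ s₁ s₂ l : ℕ, 1 ≤ s₁ + s₂ → s₁ + s₂ + l = n → ∀ i j j' : ℤ,
        ‖(D1^[s₁] (D2^[s₂] X)) i j‖ * ‖(Dseq^[l] q) j'‖ ≤ H) →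
      ∀ i, ‖(Dseq^[n] (subdivide (maskAverage^[n] β) X q)) i
        - (2 : ℝ)⁻¹ ^ n • subdivide β X (Dseq^[n] q) i‖ ≤ A * H := by
  induction n with
  | zero => exact ⟨0, le_rfl, fun X q H _ _ i => by simp⟩
  | succ n ih =>
    obtain ⟨A₀, hA₀, h₀⟩ := ih
    obtain ⟨A₁, hA₁, h₁⟩ := exists_norm_Dseq_iterate_subdivide_le (E := E) n hβ
    obtain ⟨A₂, hA₂, h₂⟩ := exists_norm_Dseq_iterate_subdivide_le (E := E) n
      (finite_support_shift (finite_support_maskAverage hβ))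
    refine ⟨2⁻¹ * A₀ + (2⁻¹ * A₁ + A₂), by positivity, fun X q H hH₀ hH i => ?_⟩
    have e₁ := h₀ X (Dseq q) H hH₀ (fun s₁ s₂ l hs h i j j' => by
      simpa only [Function.iterate_succ_apply] using hH s₁ s₂ (l + 1) hs (by omega) i j j') i
    have e₂ := h₁ (D2 X) (fun j => q (j - 1)) H (fun s₁ s₂ l h i j j' => by
      rw [Dseq_iterate_shift]
      simpa only [Function.iterate_succ_apply] using
        hH s₁ (s₂ + 1) l (by omega) (by omega) i j (j' - 1)) i
    have e₃ := h₂ (D1 X) q H (fun s₁ s₂ l h i j j' => by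
      rw [D1_iterate_D2_iterate_D1]
      exact hH (s₁ + 1) s₂ l (by omega) (by omega) i j j') i
    rw [Function.iterate_succ_apply, Function.iterate_succ_apply' maskAverage,
      Dseq_subdivide_maskAverage (finite_support_maskAverage_iterate hβ n),
      Dseq_iterate_add, Dseq_iterate_add, Dseq_iterate_smul, Dseq_iterate_smul]
    rw [maskAverage_iterate_shift, ← Function.iterate_succ_apply,
      Function.iterate_succ_apply'] at e₃
    simp only [Pi.add_apply, Pi.smul_apply]
    rw [pow_succ', mul_smul, Function.iterate_succ_apply, add_sub_right_comm, ← smul_sub]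
    refine (norm_add_le_of_le le_rfl (norm_add_le _ _)).trans ?_
    rw [norm_smul, norm_smul, Real.norm_of_nonneg (by norm_num : (0 : ℝ) ≤ 2⁻¹)]
    linarith

theorem subdivide_smul (β : ℤ → ℝ) (X : ℤ → ℤ → (E →L[ℝ] E)) (t : ℝ) (q : ℤ → E) :
    subdivide β X (t • q) = t • subdivide β X q := by
  funext i
  simp only [subdivide, Pi.smul_apply, map_smul, smul_finsum]
  exact finsum_congr fun j => smul_comm _ _ _

end Subdivision

/-- Perturbed difference recursion for PN subdivision (key estimate in
the proof of Theorem 2).  If the symbol of `a` factors as `a(z) = ((1+z)/2)^m b(z)`,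
the perturbation matrices `M_{ij}^k` equal `I` off the band `|i − 2j| ≤ B`, are
uniformly bounded, and have mixed differences of orders `1 ≤ s₁ + s₂ ≤ m` bounded by
`c_m 2^{−(s₁+s₂)k} γ^k`, and if the normalized differences of orders `< m` of the PN
sequence `p_i^{k+1} = Σ_j a_{i−2j} M_{ij}^k p_j^k` are uniformly bounded, then
`Δ^m p_i^{k+1}/2^{−m(k+1)} = Σ_j b_{i−2j} M_{ij}^k (Δ^m p_j^k/2^{−mk}) + ε_i^k` with
`‖ε_i^k‖ ≤ c γ^k`. -/
theorem pn_perturbed_difference_recursion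
    (m B : ℕ) (a b : ℤ → ℝ)
    (hb : (Function.support b).Finite)
    (hab : ∀ i : ℤ, a i = (2 : ℝ)⁻¹ ^ m *
      ∑ r ∈ Finset.range (m + 1), (m.choose r : ℝ) * b (i - (r : ℤ)))
    (M : ℕ → ℤ → ℤ → (EuclideanSpace ℝ (Fin d) →L[ℝ] EuclideanSpace ℝ (Fin d)))
    (hMone : ∀ (k : ℕ) (i j : ℤ), (B : ℤ) < |i - 2 * j| → M k i j = 1)
    (C c_m γ : ℝ) (hC : 0 < C) (hc_m : 0 < c_m) (hγ₀ : 0 < γ) (hγ₁ : γ < 1)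
    (hMbdd : ∀ (k : ℕ) (i j : ℤ), ‖M k i j‖ ≤ C)
    (hMdiff : ∀ s₁ s₂ : ℕ, 1 ≤ s₁ + s₂ → s₁ + s₂ ≤ m → ∀ (k : ℕ) (i j : ℤ),
      ‖(D1^[s₁] (D2^[s₂] (fun i' j' => M k i' j'))) i j‖
        ≤ c_m * (2 : ℝ)⁻¹ ^ ((s₁ + s₂) * k) * γ ^ k)
    (p : ℕ → ℤ → EuclideanSpace ℝ (Fin d))
    (hrec : ∀ (k : ℕ) (i : ℤ),
      p (k + 1) i = ∑ᶠ j : ℤ, a (i - 2 * j) • M k i j (p k j))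
    (K : ℝ)
    (hlow : ∀ l : ℕ, l < m → ∀ (k : ℕ) (i : ℤ),
      ‖(2 : ℝ) ^ (l * k) • (Dseq^[l] (p k)) i‖ ≤ K) :
    ∃ c > (0 : ℝ), ∃ ε : ℕ → ℤ → EuclideanSpace ℝ (Fin d),
      (∀ (k : ℕ) (i : ℤ), ‖ε k i‖ ≤ c * γ ^ k) ∧
      ∀ (k : ℕ) (i : ℤ),
        (2 : ℝ) ^ (m * (k + 1)) • (Dseq^[m] (p (k + 1))) i
          = (∑ᶠ j : ℤ, b (i - 2 * j) • M k i j ((2 : ℝ) ^ (m * k) • (Dseq^[m] (p k)) j))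
            + ε k i := by
  obtain ⟨A, hA, hbound⟩ :=
    exists_norm_Dseq_iterate_subdivide_sub_le (E := EuclideanSpace ℝ (Fin d)) m hb
  have ha : a = maskAverage^[m] b := funext fun i => by
    rw [hab, maskAverage_iterate_apply]
  have hp : ∀ k, p (k + 1) = subdivide (maskAverage^[m] b) (M k) (p k) := fun k =>
    funext fun i => by rw [hrec, ha, subdivide]
  refine ⟨2 ^ m * A * c_m * |K| + 1, by positivity, fun k i =>
    (2 : ℝ) ^ (m * (k + 1)) • ((Dseq^[m] (p (k + 1))) i
      - (2 : ℝ)⁻¹ ^ m • subdivide b (M k) (Dseq^[m] (p k)) i), fun k i => ?_, fun k i => ?_⟩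
  · have hprod : ∀ s₁ s₂ l : ℕ, 1 ≤ s₁ + s₂ → s₁ + s₂ + l = m → ∀ i j j' : ℤ,
        ‖(D1^[s₁] (D2^[s₂] (M k))) i j‖ * ‖(Dseq^[l] (p k)) j'‖
          ≤ (2 : ℝ)⁻¹ ^ (m * k) * (c_m * |K| * γ ^ k) := by
      intro s₁ s₂ l hs hl i j j'
      have hM := hMdiff s₁ s₂ hs (by omega) k i j
      have hq : ‖(Dseq^[l] (p k)) j'‖ ≤ (2 : ℝ)⁻¹ ^ (l * k) * |K| := by
        have h := (hlow l (by omega) k j').trans (le_abs_self K)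
        rw [norm_smul, Real.norm_of_nonneg (by positivity)] at h
        rw [inv_pow, ← div_eq_inv_mul, le_div_iff₀' (by positivity)]
        exact h
      refine (mul_le_mul hM hq (norm_nonneg _) (by positivity)).trans_eq ?_
      rw [← hl, add_mul (s₁ + s₂) l k, pow_add]
      ring
    have h := hbound (M k) (p k) _ (by positivity) hprod i
    rw [← hp] at h
    rw [norm_smul, Real.norm_of_nonneg (by positivity)]
    have hγk : 0 < γ ^ k := by positivity
    have hcancel : (2 : ℝ) ^ (m * k) * (2 : ℝ)⁻¹ ^ (m * k) = 1 := by
      rw [← mul_pow]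
      norm_num
    calc _ ≤ (2 : ℝ) ^ (m * (k + 1))
          * (A * ((2 : ℝ)⁻¹ ^ (m * k) * (c_m * |K| * γ ^ k))) := by gcongr
      _ = ((2 : ℝ) ^ (m * k) * (2 : ℝ)⁻¹ ^ (m * k)) * (2 ^ m * A * c_m * |K| * γ ^ k) := by
          rw [mul_add, mul_one, pow_add]
          ring
      _ ≤ _ := by
          rw [hcancel]
          linarith
  · have hmain : ∑ᶠ j : ℤ, b (i - 2 * j) • M k i j ((2 : ℝ) ^ (m * k) • (Dseq^[m] (p k)) j)
        = (2 : ℝ) ^ (m * k) • subdivide b (M k) (Dseq^[m] (p k)) i :=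
      congrFun (subdivide_smul b (M k) ((2 : ℝ) ^ (m * k)) (Dseq^[m] (p k))) i
    have hscale : (2 : ℝ) ^ (m * (k + 1)) * (2 : ℝ)⁻¹ ^ m = (2 : ℝ) ^ (m * k) := by
      rw [mul_add, mul_one, pow_add, mul_assoc, ← mul_pow]
      norm_num
    beta_reduce
    rw [hmain, smul_sub, smul_smul, hscale]
    abel
end
end
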